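/- Let D ⊆ ℂⁿ be a B-regular bounded domain. (i) Every b-pluripolar set A ⊆ ∂D that is both a G_δ and an F_σ is completely b-pluripolar. (ii) If, moreover, the b-pluripolar hull Â is a G_δ, then there exists ψ ∈ PSH(D), ψ < 0, ψ not identically -∞, with Â = {z ∈ cl(D) : ψ*(z) = -∞}; in particular Â ∩ D is completely pluripolar in D (equal to the full -∞ set in D of a plurisubharmonic function on D not identically -∞). -/

import Mathlib

open Complex Metric MeasureTheory Filter Topology Set

noncomputable section

/-- The average of the truncation `max u (-m)` of an `EReal`-valued function `u` over the
circle of center `c` and radius `r`. -/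
noncomputable def truncCircleAvg (u : ℂ → EReal) (c : ℂ) (r : ℝ) (m : ℕ) : ℝ :=
  (2 * Real.pi)⁻¹ *
    ∫ θ in (0:ℝ)..(2 * Real.pi),
      (max (u (c + (r : ℂ) * Complex.exp (θ * Complex.I))) ((-(m : ℝ) : ℝ) : EReal)).toReal

/-- A `[-∞,∞]`-valued function is subharmonic on `U ⊆ ℂ` if it is upper semicontinuous
on `U` and satisfies the sub-mean value inequality on every closed disc contained in `U`
(expressed via averages of truncations from below). -/
def SubharmonicOn (u : ℂ → EReal) (U : Set ℂ) : Prop :=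
  UpperSemicontinuousOn u U ∧
    ∀ c r, 0 < r → Metric.closedBall c r ⊆ U →
      ∀ m : ℕ, u c ≤ ((truncCircleAvg u c r m : ℝ) : EReal)

variable {E : Type*} [NormedAddCommGroup E] [NormedSpace ℂ E]

/-- Plurisubharmonic on `D`: upper semicontinuous on `D`, with values in `[-∞, ∞)`,
whose restriction to every complex line is subharmonic.  (The constant `-∞` is allowed
here; the paper's class `PSH(D)` additionally requires `u ≢ -∞`, see `MemPSH`.) -/
def PshOn (u : E → EReal) (D : Set E) : Prop :=
  UpperSemicontinuousOn u D ∧ (∀ z ∈ D, u z ≠ ⊤) ∧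
    ∀ a b : E, SubharmonicOn (fun ζ : ℂ => u (a + ζ • b)) {ζ : ℂ | a + ζ • b ∈ D}

/-- Membership in the paper's class `PSH(D)`: plurisubharmonic and not identically `-∞`. -/
def MemPSH (u : E → EReal) (D : Set E) : Prop :=
  PshOn u D ∧ ∃ z ∈ D, u z ≠ ⊥

/-- The upper semicontinuous regularization `u*` of `u` on `cl(D)`:
`u*(x) = limsup_{z → x, z ∈ D} u(z)`. -/
noncomputable def uscReg (u : E → EReal) (D : Set E) (x : E) : EReal :=
  Filter.limsup u (nhdsWithin x D)

/-- The boundary relative extremal function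
`ω(z, A, D) = sup { u(z) : u ∈ PSH(D), u ≤ 0 on D, u* ≤ -1 on A }`. -/
noncomputable def bndExt (z : E) (A D : Set E) : EReal :=
  sSup {w : EReal | ∃ u : E → EReal, MemPSH u D ∧ (∀ y ∈ D, u y ≤ 0) ∧
    (∀ x ∈ A, uscReg u D x ≤ -1) ∧ w = u z}

/-- The upper semicontinuous regularization `ω*(·, A, D)` on `cl(D)`. -/
noncomputable def bndExtStar (x : E) (A D : Set E) : EReal :=
  Filter.limsup (fun z => bndExt z A D) (nhdsWithin x D)

/-- A bounded domain: a nonempty connected bounded open set. -/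
def IsBddDomain (D : Set E) : Prop :=
  IsOpen D ∧ IsConnected D ∧ Bornology.IsBounded D

/-- `A ⊆ ∂D` is b-pluripolar if there is `u ∈ PSH(D)`, `u ≤ 0`, `u ≢ -∞`,
with `u* = -∞` on `A`. -/
def BPluripolar (A D : Set E) : Prop :=
  ∃ u : E → EReal, PshOn u D ∧ (∀ z ∈ D, u z ≤ 0) ∧ (∃ z ∈ D, u z ≠ ⊥) ∧
    ∀ x ∈ A, uscReg u D x = ⊥

/-- The b-pluripolar hull `Â` of `A ⊆ ∂D`: all points `z ∈ cl(D)` such that `u*(z) = -∞`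
for every negative `u ∈ PSH(D)`, `u ≢ -∞`, with `u* = -∞` on `A`. -/
def bHull (A D : Set E) : Set E :=
  {z ∈ closure D | ∀ u : E → EReal, PshOn u D → (∀ y ∈ D, u y < 0) →
    (∃ y ∈ D, u y ≠ ⊥) → (∀ x ∈ A, uscReg u D x = ⊥) → uscReg u D z = ⊥}

/-- Weak regularity: for every relatively open `U ⊆ ∂D` one has `ω*(·, U, D) ≤ -1` on `U`. -/
def WeaklyRegular (D : Set E) : Prop :=
  ∀ U W : Set E, IsOpen W → U = W ∩ frontier D → ∀ x ∈ U, bndExtStar x U D ≤ -1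

/-- B-regularity (Sibony): every continuous `f : ∂D → ℝ` extends to a function
plurisubharmonic on `D` and continuous on `cl(D)` with boundary values `f`. -/
def BRegular (D : Set E) : Prop :=
  ∀ f : E → ℝ, ContinuousOn f (frontier D) →
    ∃ F : E → ℝ, ContinuousOn F (closure D) ∧
      PshOn (fun z => ((F z : ℝ) : EReal)) D ∧ ∀ x ∈ frontier D, F x = f x

/-- The extremal function `ω₁(z, K, D)`, defined with continuous-up-to-the-boundary
plurisubharmonic competitors. -/
noncomputable def bndExtCont (z : E) (K D : Set E) : EReal :=
  sSup {w : EReal | ∃ F : E → ℝ, ContinuousOn F (closure D) ∧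
    PshOn (fun y => ((F y : ℝ) : EReal)) D ∧ (∀ y ∈ closure D, F y ≤ 0) ∧
    (∀ x ∈ K, F x ≤ -1) ∧ w = ((F z : ℝ) : EReal)}

end

/-- Normalised average over `[0, 2π]`. -/
noncomputable def pavg (f : ℝ → ℝ) : ℝ := (2 * Real.pi)⁻¹ * ∫ θ in (0:ℝ)..(2 * Real.pi), f θ

/-- Integrability over `[0, 2π]`. -/
def PInt (f : ℝ → ℝ) : Prop := IntervalIntegrable f volume 0 (2 * Real.pi)

lemma pavg_mono {f g : ℝ → ℝ} (hf : PInt f) (hg : PInt g) (h : ∀ θ, f θ ≤ g θ) :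
    pavg f ≤ pavg g := by
  unfold pavg
  have := intervalIntegral.integral_mono_on (by positivity) hf hg (fun θ _ => h θ)
  gcongr

lemma pavg_const (c : ℝ) : pavg (fun _ => c) = c := by
  unfold pavg
  rw [intervalIntegral.integral_const]
  have := Real.pi_pos
  simp
  field_simp

lemma PInt.const (c : ℝ) : PInt (fun _ => c) := by simp [PInt]

lemma PInt.add {f g : ℝ → ℝ} (hf : PInt f) (hg : PInt g) : PInt (fun θ => f θ + g θ) :=
  IntervalIntegrable.add hf hg

lemma PInt.mul {f : ℝ → ℝ} (c : ℝ) (hf : PInt f) : PInt (fun θ => c * f θ) :=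
  IntervalIntegrable.const_mul hf c

lemma Continuous.pInt {f : ℝ → ℝ} (hf : Continuous f) : PInt f := hf.intervalIntegrable _ _

lemma pavg_add {f g : ℝ → ℝ} (hf : PInt f) (hg : PInt g) :
    pavg (fun θ => f θ + g θ) = pavg f + pavg g := by
  unfold pavg
  rw [intervalIntegral.integral_add hf hg]; ring

lemma pavg_mul {f : ℝ → ℝ} (c : ℝ) : pavg (fun θ => c * f θ) = c * pavg f := by
  unfold pavg
  rw [intervalIntegral.integral_const_mul]; ring

lemma PInt.of_bdd {f : ℝ → ℝ} (hf : Measurable f) {C : ℝ} (h : ∀ θ, |f θ| ≤ C) : PInt f := by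
  unfold PInt
  rw [intervalIntegrable_iff]
  exact Measure.integrableOn_of_bounded (M := C) measure_Ioc_lt_top.ne
    hf.aestronglyMeasurable (Eventually.of_forall h)

lemma pavg_tendsto {F : ℕ → ℝ → ℝ} {f : ℝ → ℝ} {C : ℝ} (hF : ∀ n, Measurable (F n))
    (hb : ∀ n θ, |F n θ| ≤ C) (hl : ∀ θ, Tendsto (fun n => F n θ) atTop (𝓝 (f θ))) :
    Tendsto (fun n => pavg (F n)) atTop (𝓝 (pavg f)) := by
  unfold pavg
  refine Tendsto.const_mul _ ?_
  refine intervalIntegral.tendsto_integral_filter_of_dominated_convergence (fun _ => C) ?_ ?_ ?_ ?_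
  · exact Eventually.of_forall fun n => (hF n).aestronglyMeasurable
  · exact Eventually.of_forall fun n => Eventually.of_forall fun θ _ => hb n θ
  · simp
  · exact Eventually.of_forall fun θ _ => hl θ

lemma pavg_sq (x r : ℝ) : pavg (fun θ => (x + r * Real.cos θ) ^ 2) = x ^ 2 + r ^ 2 / 2 := by
  have h : (fun θ => (x + r * Real.cos θ) ^ 2) =
      fun θ => (x ^ 2 + 2 * x * r * Real.cos θ) + r ^ 2 * Real.cos θ ^ 2 := by
    ext θ; ring
  have hpi := Real.pi_pos
  have h1 : pavg (fun θ => Real.cos θ) = 0 := by simp [pavg]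
  have h2 : pavg (fun θ => Real.cos θ ^ 2) = 1 / 2 := by
    simp only [pavg, integral_cos_sq]; simp; field_simp
  rw [h, pavg_add (Continuous.pInt (by fun_prop)) (Continuous.pInt (by fun_prop)),
    pavg_add (Continuous.pInt (by fun_prop)) (Continuous.pInt (by fun_prop)), pavg_const,
    pavg_mul, pavg_mul, h1, h2]
  ring

/-- One-dimensional maximum principle. -/
lemma max_principle_1d {h : ℂ → ℝ} {K V : Set ℂ} (hK : IsCompact K) (husc : UpperSemicontinuousOn h K)
    (hV : ∀ ζ ∈ K, ζ ∈ V → ∃ r : ℝ, 0 < r ∧ closedBall ζ r ⊆ K ∧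
      PInt (fun θ => h (ζ + r * Complex.exp (θ * I))) ∧
      h ζ ≤ pavg (fun θ => h (ζ + r * Complex.exp (θ * I))))
    (hb : ∀ ζ ∈ K, ζ ∉ V → h ζ ≤ 0) : ∀ ζ ∈ K, h ζ ≤ 0 := by
  intro ζ hζ
  obtain ⟨R, hR⟩ := hK.isBounded.exists_norm_le
  have key : ∀ δ : ℝ, 0 < δ → h ζ ≤ δ * R ^ 2 := by
    intro δ hδ
    have husc' : UpperSemicontinuousOn (fun ζ => h ζ + δ * ζ.re ^ 2) K :=
      husc.add (Continuous.continuousOn (by fun_prop)).upperSemicontinuousOn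
    obtain ⟨w, hw, hmax⟩ := husc'.exists_isMaxOn ⟨ζ, hζ⟩ hK
    have hm : ∀ z ∈ K, h z + δ * z.re ^ 2 ≤ h w + δ * w.re ^ 2 := fun z hz => hmax hz
    by_cases hwV : w ∈ V
    · exfalso
      obtain ⟨r, hr, hrK, hint, hle⟩ := hV w hw hwV
      have hsq : PInt (fun θ => δ * (w.re + r * Real.cos θ) ^ 2) :=
        Continuous.pInt (by fun_prop)
      have h1 : pavg (fun θ => h (w + r * Complex.exp (θ * I)) + δ * (w.re + r * Real.cos θ) ^ 2)
          ≤ pavg (fun _ => h w + δ * w.re ^ 2) := by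
        apply pavg_mono (hint.add hsq) (PInt.const _)
        intro θ
        have := hm (w + r * Complex.exp (θ * I)) (hrK (by simp [abs_of_pos hr]))
        have h3 : (w + r * Complex.exp (θ * I)).re = w.re + r * Real.cos θ := by
          simp [Complex.exp_ofReal_mul_I_re]
        rwa [h3] at this
      rw [pavg_const, pavg_add hint hsq, pavg_mul, pavg_sq] at h1
      have : 0 < δ * (r ^ 2 / 2) := by positivity
      nlinarith
    · have h1 := hm ζ hζ
      have h2 := hb w hw hwV
      have h3 : w.re ^ 2 ≤ R ^ 2 := by
        rw [sq_le_sq]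
        exact ((Complex.abs_re_le_norm w).trans (hR w hw)).trans (le_abs_self R)
      have h4 : 0 ≤ δ * ζ.re ^ 2 := by positivity
      nlinarith
  by_contra hcon
  push Not at hcon
  have h5 := key (h ζ / (2 * (R ^ 2 + 1))) (by positivity)
  have h6 : h ζ / (2 * (R ^ 2 + 1)) * R ^ 2 < h ζ := by
    rw [div_mul_eq_mul_div, div_lt_iff₀ (by positivity)]
    nlinarith [sq_nonneg R]
  linarith

/-- Approximation of a continuous function on the circle by real parts of polynomials. -/
lemma exists_poly_approx (φ : ℂ → ℝ) (hφ : Continuous φ) {η : ℝ} (hη : 0 < η) :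
    ∃ P : Polynomial ℂ, ∀ θ : ℝ,
      |φ (Complex.exp (θ * I)) - (P.eval (Complex.exp (θ * I))).re| < η := by
  have : Fact (0 < 2 * Real.pi) := ⟨by positivity⟩
  let f : C(AddCircle (2 * Real.pi), ℂ) :=
    ⟨fun x => (φ (x.toCircle : ℂ) : ℂ), by
      have := AddCircle.continuous_toCircle (T := 2 * Real.pi)
      fun_prop⟩
  have hf : f ∈ (Submodule.span ℂ (range <| @fourier (2 * Real.pi))).topologicalClosure := by
    rw [span_fourier_closure_eq_top]; trivial
  have hf' : f ∈ closure (Submodule.span ℂ (range <| @fourier (2 * Real.pi)) :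
    Set C(AddCircle (2 * Real.pi), ℂ)) := hf
  obtain ⟨g, hg, hfg⟩ := Metric.mem_closure_iff.1 hf' η hη
  have hpoly : ∃ P Q : Polynomial ℂ, ∀ x : AddCircle (2 * Real.pi),
      g x = P.eval (x.toCircle : ℂ) + (starRingEnd ℂ) (Q.eval (x.toCircle : ℂ)) := by
    clear hfg
    induction hg using Submodule.span_induction with
    | mem g hg =>
      obtain ⟨n, rfl⟩ := hg
      obtain ⟨k, rfl | rfl⟩ := n.eq_nat_or_neg
      · refine ⟨Polynomial.X ^ k, 0, fun x => ?_⟩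
        simp [fourier_apply, AddCircle.toCircle_nsmul]
      · refine ⟨0, Polynomial.X ^ k, fun x => ?_⟩
        simp [fourier_apply, AddCircle.toCircle_nsmul, AddCircle.toCircle_neg]
        rw [← inv_pow, ← Circle.coe_inv, Circle.coe_inv_eq_conj]
    | zero => exact ⟨0, 0, by simp⟩
    | add g₁ g₂ _ _ h1 h2 =>
      obtain ⟨P1, Q1, h1⟩ := h1
      obtain ⟨P2, Q2, h2⟩ := h2
      refine ⟨P1 + P2, Q1 + Q2, fun x => ?_⟩
      simp [h1, h2]; ring
    | smul c g _ h1 =>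
      obtain ⟨P1, Q1, h1⟩ := h1
      refine ⟨Polynomial.C c * P1, Polynomial.C ((starRingEnd ℂ) c) * Q1, fun x => ?_⟩
      simp [h1]; ring
  obtain ⟨P, Q, hPQ⟩ := hpoly
  refine ⟨P + Q, fun θ => ?_⟩
  have h1 := (ContinuousMap.dist_lt_iff hη).1 hfg (θ : AddCircle (2 * Real.pi))
  have hc : ((AddCircle.toCircle (θ : AddCircle (2 * Real.pi)) : Circle) : ℂ)
      = Complex.exp (θ * I) := by
    rw [AddCircle.toCircle_apply_mk, Circle.coe_exp]
    congr 2
    have := Real.pi_pos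
    push_cast
    field_simp
  rw [hPQ, hc, Complex.dist_eq] at h1
  have h2 := (Complex.abs_re_le_norm _).trans_lt h1
  simp only [f, ContinuousMap.coe_mk, hc] at h2
  simpa [sub_re, add_re] using h2

lemma pavg_poly (P : Polynomial ℂ) (c : ℂ) (r : ℝ) :
    pavg (fun θ => (P.eval (c + r * Complex.exp (θ * I))).re) = (P.eval c).re := by
  have h := (P.differentiable.diffContOnCl (s := ball c |r|)).circleAverage
  rw [Real.circleAverage_def] at h
  unfold pavg
  have h2 : ∫ θ in (0:ℝ)..(2 * Real.pi), (P.eval (c + r * Complex.exp (θ * I))).re =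
      (∫ θ in (0:ℝ)..(2 * Real.pi), (P.eval (circleMap c r θ))).re := by
    have hi : IntervalIntegrable (fun θ : ℝ => P.eval (circleMap c r θ)) volume 0 (2 * Real.pi) :=
      (Continuous.intervalIntegrable (by
        have := continuous_circleMap c r
        fun_prop) _ _)
    have := Complex.reCLM.intervalIntegral_comp_comm hi
    simpa [circleMap] using this
  rw [h2, ← h]
  simp

lemma usc_approx {h : ℂ → ℝ} {S : Set ℂ} {C : ℝ} (hS : S.Nonempty)
    (husc : UpperSemicontinuousOn h S) (hb : ∀ ζ ∈ S, |h ζ| ≤ C) :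
    ∃ φ : ℕ → ℂ → ℝ, (∀ n, Continuous (φ n)) ∧ (∀ n, ∀ ζ ∈ S, h ζ ≤ φ n ζ) ∧
      (∀ n, ∀ ζ ∈ S, |φ n ζ| ≤ C) ∧
      ∀ ζ ∈ S, Tendsto (fun n => φ n ζ) atTop (𝓝 (h ζ)) := by
  have : Nonempty S := hS.to_subtype
  let φ : ℕ → ℂ → ℝ := fun n ζ => ⨆ ξ : S, (h ξ - n * dist ζ ξ)
  have hC : ∀ ξ : S, h ξ ≤ C := fun ξ => (abs_le.1 (hb ξ ξ.2)).2
  have hbd : ∀ (n : ℕ) (ζ : ℂ), BddAbove (range fun ξ : S => h ξ - n * dist ζ ξ) := by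
    intro n ζ
    refine ⟨C, ?_⟩
    rintro _ ⟨ξ, rfl⟩
    have : 0 ≤ (n : ℝ) * dist ζ ξ := by positivity
    have := hC ξ
    simp only
    linarith
  have hle : ∀ n ζ, φ n ζ ≤ C := by
    intro n ζ
    refine ciSup_le fun ξ => ?_
    have : 0 ≤ (n : ℝ) * dist ζ ξ := by positivity
    have := hC ξ
    linarith
  have hge : ∀ n, ∀ ζ ∈ S, h ζ ≤ φ n ζ := by
    intro n ζ hζ
    have := le_ciSup (hbd n ζ) ⟨ζ, hζ⟩
    simpa using this
  refine ⟨φ, ?_, hge, ?_, ?_⟩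
  · intro n
    have hl : LipschitzWith (n : NNReal) (φ n) := by
      refine LipschitzWith.of_le_add_mul _ fun x y => ?_
      refine ciSup_le fun ξ => ?_
      have h1 := le_ciSup (hbd n y) ξ
      have h2 : dist y ξ ≤ dist x ξ + dist x y := by
        rw [dist_comm x y]; linarith [dist_triangle y x (ξ : ℂ)]
      have h3 : (n : ℝ) * dist y ξ ≤ n * (dist x ξ + dist x y) := by gcongr
      have h4 : (((n : NNReal) : ℝ)) = n := by simp
      rw [h4]
      change h ξ - n * dist x ξ ≤ (⨆ ξ : S, (h ξ - n * dist y ξ)) + n * dist x y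
      linarith
    exact hl.continuous
  · intro n ζ hζ
    exact abs_le.2 ⟨(abs_le.1 (hb ζ hζ)).1.trans (hge n ζ hζ), hle n ζ⟩
  · intro ζ hζ
    rw [Metric.tendsto_atTop]
    intro ε hε
    have h1 := husc ζ hζ (h ζ + ε / 2) (by linarith)
    obtain ⟨ρ, hρ, hρ'⟩ := Metric.mem_nhdsWithin_iff.1 h1
    obtain ⟨N, hN⟩ := exists_nat_gt (2 * C / ρ)
    refine ⟨N, fun n hn => ?_⟩
    have h2 : φ n ζ ≤ h ζ + ε / 2 := by
      refine ciSup_le fun ξ => ?_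
      by_cases hd : dist (ξ : ℂ) ζ < ρ
      · have h3 : h ξ < h ζ + ε / 2 := hρ' ⟨hd, ξ.2⟩
        have : 0 ≤ (n : ℝ) * dist ζ ξ := by positivity
        linarith
      · push Not at hd
        rw [dist_comm] at hd
        have h4 : 2 * C < N * ρ := by rwa [div_lt_iff₀ hρ] at hN
        have h5 : (N : ℝ) * ρ ≤ n * dist ζ ξ := by gcongr
        have := (abs_le.1 (hb ζ hζ)).1
        have := hC ξ
        linarith
    rw [Real.dist_eq, abs_of_nonneg (by linarith [hge n ζ hζ])]
    linarith

lemma norm_exp_I (θ : ℝ) : ‖Complex.exp (θ * I)‖ = 1 := Complex.norm_exp_ofReal_mul_I θ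

lemma submean_1d {h : ℂ → ℝ} {C : ℝ} (husc : UpperSemicontinuousOn h (closedBall 0 1))
    (hb : ∀ ζ ∈ closedBall (0 : ℂ) 1, |h ζ| ≤ C)
    (hV : ∀ ζ ∈ ball (0 : ℂ) 1, ∃ r : ℝ, 0 < r ∧ closedBall ζ r ⊆ closedBall 0 1 ∧
      PInt (fun θ => h (ζ + r * Complex.exp (θ * I))) ∧
      h ζ ≤ pavg (fun θ => h (ζ + r * Complex.exp (θ * I)))) :
    h 0 ≤ pavg (fun θ => h (Complex.exp (θ * I))) := by
  have hsub : sphere (0 : ℂ) 1 ⊆ closedBall 0 1 := sphere_subset_closedBall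
  have hcirc : ∀ θ : ℝ, Complex.exp (θ * I) ∈ sphere (0 : ℂ) 1 := fun θ => by
    simp
  have hcc : Continuous (fun θ : ℝ => Complex.exp (θ * I)) := by fun_prop
  obtain ⟨φ, hφc, hφge, hφb, hφl⟩ := usc_approx (S := sphere (0 : ℂ) 1) ⟨1, by simp⟩
    (husc.mono hsub) (fun ζ hζ => hb ζ (hsub hζ))
  have key : ∀ n, ∀ η : ℝ, 0 < η → h 0 ≤ pavg (fun θ => φ n (Complex.exp (θ * I))) + η + η := by
    intro n η hη
    obtain ⟨P, hP⟩ := exists_poly_approx (φ n) (hφc n) hη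
    have hPc : Continuous (fun ζ : ℂ => (P.eval ζ).re) := by fun_prop
    have hmp := max_principle_1d (h := fun ζ => h ζ + (-(P.eval ζ).re - η))
      (K := closedBall 0 1) (V := ball 0 1) (isCompact_closedBall _ _)
      (husc.add (Continuous.continuousOn (by fun_prop)).upperSemicontinuousOn) ?_ ?_ 0 (by simp)
    · have h1 := pavg_poly P 0 1
      simp only [ofReal_one, one_mul, zero_add] at h1
      have h2 : pavg (fun θ => (P.eval (Complex.exp (θ * I))).re) ≤
          pavg (fun θ => φ n (Complex.exp (θ * I)) + η) := by
        apply pavg_mono (Continuous.pInt (by fun_prop)) (Continuous.pInt (by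
          have := hφc n
          fun_prop))
        intro θ
        have := (abs_lt.1 (hP θ)).1
        linarith
      rw [pavg_add (Continuous.pInt (by have := hφc n; fun_prop)) (PInt.const _),
        pavg_const] at h2
      linarith
    · intro ζ _ hζ
      obtain ⟨r, hr, hrs, hint, hle⟩ := hV ζ hζ
      have hc : Continuous fun θ : ℝ => -(P.eval (ζ + r * Complex.exp (θ * I))).re - η := by
        fun_prop
      refine ⟨r, hr, hrs, hint.add hc.pInt, ?_⟩
      rw [pavg_add hint hc.pInt]
      have h1 : pavg (fun θ : ℝ => -(P.eval (ζ + r * Complex.exp (θ * I))).re - η)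
          = -(P.eval ζ).re - η := by
        have : (fun θ : ℝ => -(P.eval (ζ + r * Complex.exp (θ * I))).re - η) =
          fun θ : ℝ => (-1) * (P.eval (ζ + r * Complex.exp (θ * I))).re + (-η) := by
          ext; ring
        rw [this, pavg_add (Continuous.pInt (by fun_prop)) (PInt.const _), pavg_mul, pavg_poly,
          pavg_const]
        ring
      rw [h1]
      linarith
    · intro ζ hζ hζ'
      have hs : ζ ∈ sphere (0 : ℂ) 1 := by
        simp only [mem_closedBall, mem_ball, mem_sphere] at *
        linarith
      have hn : ‖ζ‖ = 1 := by simpa using hs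
      have he : Complex.exp (ζ.arg * I) = ζ := by
        have := Complex.norm_mul_exp_arg_mul_I ζ
        rwa [hn, ofReal_one, one_mul] at this
      have h1 := hP ζ.arg
      rw [he] at h1
      have h2 := hφge n ζ hs
      have := (abs_lt.1 h1).2
      linarith
  have key2 : ∀ n, h 0 ≤ pavg (fun θ => φ n (Complex.exp (θ * I))) := by
    intro n
    refine le_of_forall_pos_le_add fun η hη => ?_
    have := key n (η / 2) (by positivity)
    linarith
  have hl : Tendsto (fun n => pavg (fun θ => φ n (Complex.exp (θ * I)))) atTop
      (𝓝 (pavg (fun θ => h (Complex.exp (θ * I))))) :=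
    pavg_tendsto (C := C) (fun n => ((hφc n).comp hcc).measurable)
      (fun n θ => hφb n _ (hcirc θ)) (fun θ => hφl _ (hcirc θ))
  exact ge_of_tendsto' hl key2

section RP
variable {E : Type*} [NormedAddCommGroup E] [NormedSpace ℂ E]

/-- The closed disc with centre `a` and direction `b` lies in `D`. -/
def DiscIn (a b : E) (D : Set E) : Prop := ∀ ζ : ℂ, ‖ζ‖ ≤ 1 → a + ζ • b ∈ D

lemma DiscIn.circ {a b : E} {D : Set E} (h : DiscIn a b D) (θ : ℝ) :
    a + Complex.exp (θ * I) • b ∈ D := h _ (norm_exp_I θ).le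

lemma DiscIn.center {a b : E} {D : Set E} (h : DiscIn a b D) : a ∈ D := by
  simpa using h 0 (by simp)

lemma DiscIn.mono {a b : E} {D D' : Set E} (h : DiscIn a b D) (hs : D ⊆ D') : DiscIn a b D' :=
  fun ζ hζ => hs (h ζ hζ)

/-- Bounded real-valued plurisubharmonic functions. -/
structure RP (g : E → ℝ) (D : Set E) : Prop where
  usc : UpperSemicontinuousOn g D
  bdd : ∃ C, ∀ z ∈ D, |g z| ≤ C
  mean : ∀ a b, DiscIn a b D → g a ≤ pavg (fun θ => g (a + Complex.exp (θ * I) • b))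

lemma usc_circ {β : Type*} [Preorder β] {g : E → β} {D : Set E} (hg : UpperSemicontinuousOn g D) {a b : E}
    (h : ∀ θ : ℝ, a + Complex.exp (θ * I) • b ∈ D) :
    UpperSemicontinuous (fun θ : ℝ => g (a + Complex.exp (θ * I) • b)) := by
  have hc : Continuous (fun θ : ℝ => a + Complex.exp (θ * I) • b) := by fun_prop
  intro θ y hy
  have h1 := hg _ (h θ) y hy
  have ht : Tendsto (fun θ : ℝ => a + Complex.exp (θ * I) • b) (𝓝 θ)
      (𝓝[D] (a + Complex.exp (θ * I) • b)) :=
    tendsto_nhdsWithin_iff.2 ⟨hc.tendsto θ, Eventually.of_forall h⟩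
  exact ht.eventually h1

lemma RP.meas {g : E → ℝ} {D : Set E} (hg : RP g D) {a b : E} (h : DiscIn a b D) :
    Measurable (fun θ : ℝ => g (a + Complex.exp (θ * I) • b)) :=
  (usc_circ hg.usc h.circ).measurable

lemma RP.pInt {g : E → ℝ} {D : Set E} (hg : RP g D) {a b : E} (h : DiscIn a b D) :
    PInt (fun θ : ℝ => g (a + Complex.exp (θ * I) • b)) := by
  obtain ⟨C, hC⟩ := hg.bdd
  exact PInt.of_bdd (hg.meas h) (fun θ => hC _ (h.circ θ))

lemma RP.mono {g : E → ℝ} {D D' : Set E} (hg : RP g D) (hs : D' ⊆ D) : RP g D' :=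
  ⟨hg.usc.mono hs, hg.bdd.imp fun _ h z hz => h z (hs hz), fun a b h => hg.mean a b (h.mono hs)⟩

lemma RP.congr_on {f g : E → ℝ} {D : Set E} (hf : RP f D) (h : ∀ z ∈ D, g z = f z) : RP g D := by
  refine ⟨?_, ?_, fun a b hd => ?_⟩
  · intro z hz y hy
    rw [h z hz] at hy
    filter_upwards [hf.usc z hz y hy, self_mem_nhdsWithin] with w hw hwD
    rwa [h w hwD]
  · obtain ⟨C, hC⟩ := hf.bdd
    exact ⟨C, fun z hz => by rw [h z hz]; exact hC z hz⟩
  · have : (fun θ : ℝ => g (a + Complex.exp (θ * I) • b)) =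
        fun θ : ℝ => f (a + Complex.exp (θ * I) • b) := by
      ext θ; exact h _ (hd.circ θ)
    rw [h a hd.center, this]
    exact hf.mean a b hd

lemma RP.const (c : ℝ) (D : Set E) : RP (fun _ => c) D :=
  ⟨upperSemicontinuousOn_const, ⟨|c|, fun _ _ => le_rfl⟩, fun _ _ _ => (pavg_const c).ge⟩

lemma RP.max {f g : E → ℝ} {D : Set E} (hf : RP f D) (hg : RP g D) :
    RP (fun z => max (f z) (g z)) D := by
  have husc : UpperSemicontinuousOn (fun z => Max.max (f z) (g z)) D := hf.usc.sup hg.usc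
  obtain ⟨C, hC⟩ := hf.bdd
  obtain ⟨C', hC'⟩ := hg.bdd
  have hb : ∀ z ∈ D, |Max.max (f z) (g z)| ≤ Max.max C C' := fun z hz =>
    (abs_max_le_max_abs_abs).trans (max_le_max (hC z hz) (hC' z hz))
  refine ⟨husc, ⟨_, hb⟩, fun a b h => ?_⟩
  have hi : PInt (fun θ : ℝ => Max.max (f (a + Complex.exp (θ * I) • b))
      (g (a + Complex.exp (θ * I) • b))) :=
    PInt.of_bdd (usc_circ husc h.circ).measurable (fun θ => hb _ (h.circ θ))
  refine max_le ?_ ?_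
  · exact (hf.mean a b h).trans (pavg_mono (hf.pInt h) hi fun θ => le_max_left _ _)
  · exact (hg.mean a b h).trans (pavg_mono (hg.pInt h) hi fun θ => le_max_right _ _)

lemma RP.add {f g : E → ℝ} {D : Set E} (hf : RP f D) (hg : RP g D) :
    RP (fun z => f z + g z) D := by
  obtain ⟨C, hC⟩ := hf.bdd
  obtain ⟨C', hC'⟩ := hg.bdd
  refine ⟨hf.usc.add hg.usc, ⟨C + C', fun z hz => (abs_add_le _ _).trans
    (add_le_add (hC z hz) (hC' z hz))⟩, fun a b h => ?_⟩
  rw [pavg_add (hf.pInt h) (hg.pInt h)]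
  exact add_le_add (hf.mean a b h) (hg.mean a b h)

lemma RP.mul {f : E → ℝ} {D : Set E} {c : ℝ} (hc : 0 ≤ c) (hf : RP f D) :
    RP (fun z => c * f z) D := by
  obtain ⟨C, hC⟩ := hf.bdd
  refine ⟨?_, ⟨c * C, fun z hz => ?_⟩, fun a b h => ?_⟩
  · exact (continuous_const_mul c).comp_upperSemicontinuousOn hf.usc
      (fun x y hxy => mul_le_mul_of_nonneg_left hxy hc)
  · rw [abs_mul, abs_of_nonneg hc]
    exact mul_le_mul_of_nonneg_left (hC z hz) hc
  · rw [pavg_mul]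
    exact mul_le_mul_of_nonneg_left (hf.mean a b h) hc

lemma RP.sum {f : ℕ → E → ℝ} {D : Set E} (hf : ∀ n, RP (f n) D) (N : ℕ) :
    RP (fun z => ∑ i ∈ Finset.range N, f i z) D := by
  induction N with
  | zero => simpa using RP.const 0 D
  | succ N ih =>
    simp only [Finset.sum_range_succ]
    exact ih.add (hf N)

/-- Gluing: a bounded function which is locally plurisubharmonic is plurisubharmonic. -/
lemma RP.of_local {g : E → ℝ} {D : Set E} (hb : ∃ C, ∀ z ∈ D, |g z| ≤ C)
    (hloc : ∀ z ∈ D, ∃ ρ > 0, ball z ρ ⊆ D ∧ RP g (ball z ρ)) : RP g D := by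
  have husc : UpperSemicontinuousOn g D := by
    intro z hz y hy
    obtain ⟨ρ, hρ, hs, hr⟩ := hloc z hz
    have := hr.usc z (mem_ball_self hρ) y hy
    rw [isOpen_ball.nhdsWithin_eq (mem_ball_self hρ)] at this
    exact this.filter_mono nhdsWithin_le_nhds
  refine ⟨husc, hb, fun a b h => ?_⟩
  obtain ⟨C, hC⟩ := hb
  have hmem : ∀ ζ ∈ closedBall (0 : ℂ) 1, a + ζ • b ∈ D := fun ζ hζ => h ζ (by simpa using hζ)
  have hlc : Continuous (fun ζ : ℂ => a + ζ • b) := by fun_prop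
  have := submean_1d (h := fun ζ => g (a + ζ • b)) (C := C)
    (husc.comp hlc.continuousOn hmem) (fun ζ hζ => hC _ (hmem ζ hζ)) ?_
  · simpa using this
  · intro ζ hζ
    have hζ1 : ‖ζ‖ < 1 := by simpa using hζ
    obtain ⟨ρ, hρ, hs, hr⟩ := hloc (a + ζ • b) (hmem ζ (ball_subset_closedBall hζ))
    set r : ℝ := min (1 - ‖ζ‖) (ρ / (‖b‖ + 1) / 2) with hrdef
    have hb1 : 0 < ‖b‖ + 1 := by positivity
    have hr0 : 0 < r := by
      apply lt_min
      · linarith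
      · positivity
    have hrb : r * ‖b‖ < ρ := by
      have h1 : r ≤ ρ / (‖b‖ + 1) / 2 := min_le_right _ _
      have h2 : r * (‖b‖ + 1) ≤ ρ / 2 := by
        calc r * (‖b‖ + 1) ≤ (ρ / (‖b‖ + 1) / 2) * (‖b‖ + 1) := by gcongr
          _ = ρ / 2 := by field_simp
      nlinarith [norm_nonneg b]
    have hdisc : DiscIn (a + ζ • b) ((r : ℂ) • b) (ball (a + ζ • b) ρ) := by
      intro ξ hξ
      rw [mem_ball, dist_eq_norm, add_sub_cancel_left, norm_smul, norm_smul, norm_real,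
        Real.norm_of_nonneg hr0.le]
      calc ‖ξ‖ * (r * ‖b‖) ≤ 1 * (r * ‖b‖) := by gcongr
        _ < ρ := by linarith
    have heq : ∀ θ : ℝ, a + (ζ + r * Complex.exp (θ * I)) • b =
        a + ζ • b + Complex.exp (θ * I) • (r : ℂ) • b := by
      intro θ; module
    refine ⟨r, hr0, ?_, ?_, ?_⟩
    · apply closedBall_subset_closedBall'
      have : r ≤ 1 - ‖ζ‖ := min_le_left _ _
      rw [dist_zero_right]; linarith
    · simp only [heq]
      exact hr.pInt hdisc
    · simp only [heq]
      exact hr.mean _ _ hdisc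
end RP

section Psh
variable {E : Type*}

/-- Truncation from below at level `-m`, real valued. -/
noncomputable def tr (u : E → EReal) (m : ℕ) (z : E) : ℝ :=
  (max (u z) ((-(m : ℝ) : ℝ) : EReal)).toReal

lemma coe_tr {u : E → EReal} {z : E} (h : u z ≠ ⊤) (m : ℕ) :
    (tr u m z : EReal) = max (u z) ((-(m : ℝ) : ℝ) : EReal) := by
  unfold tr
  apply EReal.coe_toReal
  · exact (max_lt (lt_top_iff_ne_top.2 h) (EReal.coe_lt_top _)).ne
  · exact ((EReal.bot_lt_coe _).trans_le (le_max_right _ _)).ne'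

lemma tr_ge {u : E → EReal} {z : E} (h : u z ≠ ⊤) (m : ℕ) : -(m : ℝ) ≤ tr u m z := by
  rw [← EReal.coe_le_coe_iff, coe_tr h]; exact le_max_right _ _

lemma le_tr {u : E → EReal} {z : E} (h : u z ≠ ⊤) (m : ℕ) : u z ≤ tr u m z := by
  rw [coe_tr h]; exact le_max_left _ _

lemma tr_le {u : E → EReal} {z : E} (h : u z ≤ 0) (m : ℕ) : tr u m z ≤ 0 := by
  rw [← EReal.coe_le_coe_iff, coe_tr (ne_top_of_le_ne_top EReal.zero_ne_top h)]
  refine max_le h ?_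
  exact_mod_cast (by simp : -(m : ℝ) ≤ 0)

lemma tr_coe (g : E → ℝ) (m : ℕ) (z : E) :
    tr (fun z => (g z : EReal)) m z = max (g z) (-(m : ℝ)) := by
  rw [← EReal.coe_eq_coe_iff, coe_tr (u := fun z => (g z : EReal)) (z := z) (EReal.coe_ne_top _)]
  exact (EReal.coe_strictMono.monotone.map_max).symm

variable [NormedAddCommGroup E] [NormedSpace ℂ E]

lemma psh_iff {u : E → EReal} {D : Set E} : PshOn u D ↔ UpperSemicontinuousOn u D ∧
    (∀ z ∈ D, u z ≠ ⊤) ∧ ∀ a b, DiscIn a b D → ∀ m : ℕ,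
      u a ≤ ((pavg (fun θ => tr u m (a + Complex.exp (θ * I) • b)) : ℝ) : EReal) := by
  constructor
  · rintro ⟨h1, h2, h3⟩
    refine ⟨h1, h2, fun a b h m => ?_⟩
    have := (h3 a b).2 0 1 one_pos (fun ζ hζ => h ζ (by simpa using hζ)) m
    simpa [truncCircleAvg, pavg, tr] using this
  · rintro ⟨h1, h2, h3⟩
    refine ⟨h1, h2, fun a b => ⟨?_, fun c r hr hs m => ?_⟩⟩
    · exact h1.comp (by fun_prop : Continuous fun ζ : ℂ => a + ζ • b).continuousOn (fun ζ hζ => hζ)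
    · have hd : DiscIn (a + c • b) ((r : ℂ) • b) D := by
        intro ζ hζ
        have h4 : c + r * ζ ∈ closedBall c r := by
          simp only [mem_closedBall, dist_self_add_left, norm_mul, norm_real, Real.norm_eq_abs,
            abs_of_pos hr]
          nlinarith
        have h5 : a + (c + r * ζ) • b ∈ D := hs h4
        convert h5 using 1
        module
      have := h3 _ _ hd m
      have heq : ∀ θ : ℝ, a + c • b + Complex.exp (θ * I) • (r : ℂ) • b =
          a + (c + r * Complex.exp (θ * I)) • b := by
        intro θ; module
      simp only [heq] at this
      simpa [truncCircleAvg, pavg, tr] using this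

lemma usc_tr {u : E → EReal} {D : Set E} (hu : UpperSemicontinuousOn u D)
    (ht : ∀ z ∈ D, u z ≠ ⊤) (m : ℕ) : UpperSemicontinuousOn (tr u m) D := by
  intro z hz y hy
  have h1 : max (u z) ((-(m : ℝ) : ℝ) : EReal) < (y : EReal) := by
    rw [← coe_tr (ht z hz)]; exact_mod_cast hy
  filter_upwards [hu z hz y ((le_max_left _ _).trans_lt h1), self_mem_nhdsWithin] with w hw hwD
  have : (tr u m w : EReal) < y := by
    rw [coe_tr (ht w hwD)]
    exact max_lt hw ((le_max_right _ _).trans_lt h1)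
  exact_mod_cast this

lemma PshOn.rp {u : E → EReal} {D : Set E} (hu : PshOn u D) (h0 : ∀ z ∈ D, u z ≤ 0) (m : ℕ) :
    RP (tr u m) D := by
  obtain ⟨h1, h2, h3⟩ := psh_iff.1 hu
  have hb : ∀ z ∈ D, |tr u m z| ≤ m := fun z hz =>
    abs_le.2 ⟨tr_ge (h2 z hz) m, (tr_le (h0 z hz) m).trans (by positivity)⟩
  refine ⟨usc_tr h1 h2 m, ⟨m, hb⟩, fun a b h => ?_⟩
  have hi : PInt (fun θ => tr u m (a + Complex.exp (θ * I) • b)) :=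
    PInt.of_bdd (usc_circ (usc_tr h1 h2 m) h.circ).measurable fun θ => hb _ (h.circ θ)
  rw [← EReal.coe_le_coe_iff, coe_tr (h2 a h.center)]
  refine max_le (h3 a b h m) ?_
  rw [EReal.coe_le_coe_iff, ← pavg_const (-(m : ℝ))]
  exact pavg_mono (PInt.const _) hi fun θ => tr_ge (h2 _ (h.circ θ)) m

lemma psh_of_tr {u : E → EReal} {D : Set E} (hu : UpperSemicontinuousOn u D)
    (ht : ∀ z ∈ D, u z ≠ ⊤) (h : ∀ m, RP (tr u m) D) : PshOn u D := by
  rw [psh_iff]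
  refine ⟨hu, ht, fun a b hd m => ?_⟩
  refine (le_tr (ht a hd.center) m).trans ?_
  exact_mod_cast (h m).mean a b hd

lemma RP.psh {g : E → ℝ} {D : Set E} (hg : RP g D) : PshOn (fun z => (g z : EReal)) D := by
  refine psh_of_tr ?_ (fun z _ => EReal.coe_ne_top _) fun m => ?_
  · exact continuous_coe_real_ereal.comp_upperSemicontinuousOn hg.usc
      EReal.coe_strictMono.monotone
  · have : tr (fun z => (g z : EReal)) m = fun z => Max.max (g z) (-(m : ℝ)) := by
      ext z; exact tr_coe g m z
    rw [this]
    exact hg.max (RP.const _ D)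

lemma rp_of_psh {g : E → ℝ} {D : Set E} (hg : PshOn (fun z => (g z : EReal)) D)
    {C : ℝ} (hC : ∀ z ∈ D, |g z| ≤ C) : RP g D := by
  obtain ⟨h1, h2, h3⟩ := psh_iff.1 hg
  refine ⟨?_, ⟨C, hC⟩, fun a b h => ?_⟩
  · intro z hz y hy
    have hy' : (g z : EReal) < (y : EReal) := by exact_mod_cast hy
    filter_upwards [h1 z hz y hy'] with w hw
    exact EReal.coe_lt_coe_iff.1 hw
  · obtain ⟨m, hm⟩ := exists_nat_gt C
    have := h3 a b h m
    have heq : ∀ θ : ℝ, tr (fun z => (g z : EReal)) m (a + Complex.exp (θ * I) • b) =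
        g (a + Complex.exp (θ * I) • b) := by
      intro θ
      rw [tr_coe, max_eq_left]
      have := (abs_le.1 (hC _ (h.circ θ))).1
      linarith
    simp only [heq] at this
    exact_mod_cast this

lemma PshOn.max {u v : E → EReal} {D : Set E} (hu : PshOn u D) (hv : PshOn v D)
    (hu0 : ∀ z ∈ D, u z ≤ 0) (hv0 : ∀ z ∈ D, v z ≤ 0) :
    PshOn (fun z => max (u z) (v z)) D := by
  have ht : ∀ z ∈ D, Max.max (u z) (v z) ≠ ⊤ := fun z hz =>
    ne_top_of_le_ne_top EReal.zero_ne_top (max_le (hu0 z hz) (hv0 z hz))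
  refine psh_of_tr (hu.1.sup hv.1) ht fun m => ?_
  refine ((hu.rp hu0 m).max (hv.rp hv0 m)).congr_on fun z hz => ?_
  rw [← EReal.coe_eq_coe_iff, coe_tr (u := fun z => Max.max (u z) (v z)) (z := z) (ht z hz), EReal.coe_strictMono.monotone.map_max,
    coe_tr (hu.2.1 z hz), coe_tr (hv.2.1 z hz), max_max_max_comm, max_self]

/-- Decreasing limits of bounded plurisubharmonic functions. -/
lemma psh_iInf {S : ℕ → E → ℝ} {D : Set E} (hS : ∀ n, RP (S n) D)
    (h0 : ∀ n, ∀ z ∈ D, S n z ≤ 0) (hanti : ∀ z ∈ D, Antitone fun n => S n z) :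
    PshOn (fun z => ⨅ n, (S n z : EReal)) D := by
  have husc : UpperSemicontinuousOn (fun z => ⨅ n, (S n z : EReal)) D :=
    upperSemicontinuousOn_iInf fun n => (hS n).psh.1
  have hle : ∀ z ∈ D, (⨅ n, (S n z : EReal)) ≤ 0 := fun z hz =>
    (iInf_le _ 0).trans (by exact_mod_cast h0 0 z hz)
  have ht : ∀ z ∈ D, (⨅ n, (S n z : EReal)) ≠ ⊤ := fun z hz =>
    ne_top_of_le_ne_top EReal.zero_ne_top (hle z hz)
  refine psh_of_tr husc ht fun m => ?_
  set ψ : E → EReal := fun z => ⨅ n, (S n z : EReal) with hψ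
  have hb : ∀ z ∈ D, |tr ψ m z| ≤ m := fun z hz =>
    abs_le.2 ⟨tr_ge (u := ψ) (ht z hz) m, (tr_le (u := ψ) (hle z hz) m).trans (by positivity)⟩
  refine ⟨usc_tr husc ht m, ⟨m, hb⟩, fun a b hd => ?_⟩
  have hRP : ∀ n, RP (fun z => Max.max (S n z) (-(m : ℝ))) D := fun n => (hS n).max (RP.const _ D)
  have hlim : ∀ z ∈ D, Tendsto (fun n => Max.max (S n z) (-(m : ℝ))) atTop (𝓝 (tr ψ m z)) := by
    intro z hz
    have h1 : Tendsto (fun n => (S n z : EReal)) atTop (𝓝 (ψ z)) :=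
      tendsto_atTop_iInf fun i j hij => by exact_mod_cast hanti z hz hij
    have h2 := h1.max (tendsto_const_nhds (x := ((-(m : ℝ) : ℝ) : EReal)))
    rw [← coe_tr (u := ψ) (ht z hz)] at h2
    rw [← EReal.tendsto_coe]
    refine h2.congr fun n => ?_
    exact (EReal.coe_strictMono.monotone.map_max).symm
  have h4 : Tendsto (fun n => pavg fun θ => Max.max (S n (a + Complex.exp (θ * I) • b)) (-(m : ℝ)))
      atTop (𝓝 (pavg fun θ => tr ψ m (a + Complex.exp (θ * I) • b))) := by
    refine pavg_tendsto (C := m) (fun n => (hRP n).meas hd) (fun n θ => ?_)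
      (fun θ => hlim _ (hd.circ θ))
    refine abs_le.2 ⟨le_max_right _ _, max_le ((h0 n _ (hd.circ θ)).trans (by positivity)) ?_⟩
    have : (0 : ℝ) ≤ m := by positivity
    linarith
  exact le_of_tendsto_of_tendsto' (hlim a hd.center) h4 fun n => (hRP n).mean a b hd

/-- The `-∞`-set of a negative psh function on a connected open set has dense complement. -/
lemma psh_dense {u : E → EReal} {D : Set E} (hD : IsOpen D) (hc : IsPreconnected D)
    (hu : PshOn u D) (h0 : ∀ z ∈ D, u z ≤ 0) (hne : ∃ z ∈ D, u z ≠ ⊥) {O : Set E} (hO : IsOpen O)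
    (hOD : (O ∩ D).Nonempty) : ∃ s ∈ O ∩ D, u s ≠ ⊥ := by
  by_contra hcon
  push Not at hcon
  set W : Set E := interior {p | p ∈ D ∧ u p = ⊥} with hW
  have hsub : D ⊆ W := by
    refine hc.subset_of_closure_inter_subset isOpen_interior ?_ ?_
    · obtain ⟨p, hp⟩ := hOD
      refine ⟨p, hp.2, ?_⟩
      rw [hW, mem_interior]
      exact ⟨O ∩ D, fun q hq => ⟨hq.2, hcon q hq⟩, hO.inter hD, hp⟩
    · rintro z ⟨hzW, hzD⟩
      obtain ⟨R', hR', hball⟩ := Metric.isOpen_iff.1 hD z hzD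
      obtain ⟨R, hR, hRR⟩ : ∃ R : ℝ, 0 < R ∧ 3 * R ≤ R' := ⟨R' / 3, by positivity, by linarith⟩
      obtain ⟨w, hwW, hwz⟩ := Metric.mem_closure_iff.1 hzW R hR
      rw [hW, mem_interior]
      refine ⟨ball z R, fun p hp => ?_, isOpen_ball, mem_ball_self hR⟩
      have hpz : dist p z < R := hp
      have hpD : p ∈ D := hball (by rw [mem_ball]; linarith)
      refine ⟨hpD, ?_⟩
      have hdisc : DiscIn p (w - p) D := by
        intro ζ hζ
        apply hball
        have h1 : dist (p + ζ • (w - p)) p ≤ 2 * R := by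
          rw [dist_self_add_left, norm_smul, ← dist_eq_norm]
          have h2 : dist w p ≤ 2 * R := by
            have := dist_triangle w z p
            rw [dist_comm w z, dist_comm z p] at this
            linarith
          calc ‖ζ‖ * dist w p ≤ 1 * (2 * R) := by gcongr
            _ = 2 * R := one_mul _
        rw [mem_ball]
        have := dist_triangle (p + ζ • (w - p)) p z
        linarith
      have hcont : Continuous (fun θ : ℝ => p + Complex.exp (θ * I) • (w - p)) := by fun_prop
      have hev : ∀ᶠ θ : ℝ in 𝓝 (0 : ℝ), u (p + Complex.exp (θ * I) • (w - p)) = ⊥ := by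
        have h1 := hcont.tendsto 0
        simp only [ofReal_zero, zero_mul, Complex.exp_zero, one_smul, add_sub_cancel] at h1
        filter_upwards [h1 (isOpen_interior.mem_nhds hwW)] with θ hθ
        exact (interior_subset hθ).2
      obtain ⟨η', hη', hηb⟩ := Metric.eventually_nhds_iff.1 hev
      obtain ⟨η, hη, hη1, hη2⟩ : ∃ η : ℝ, 0 < η ∧ η < η' ∧ η ≤ 2 * Real.pi := by
        refine ⟨min (η' / 2) 1, by positivity, ?_, ?_⟩
        · exact (min_le_left _ _).trans_lt (by linarith)
        · exact (min_le_right _ _).trans (by linarith [Real.pi_gt_three])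
      have hest : ∀ m : ℕ, pavg (fun θ => tr u m (p + Complex.exp (θ * I) • (w - p))) ≤
          (2 * Real.pi)⁻¹ * (-(m : ℝ) * η) := by
        intro m
        have hi := (hu.rp h0 m).pInt hdisc
        unfold PInt at hi
        have hi1 : IntervalIntegrable (fun θ : ℝ => tr u m (p + Complex.exp (θ * I) • (w - p)))
            volume 0 η := hi.mono_set (by
              rw [uIcc_of_le hη.le, uIcc_of_le (hη.le.trans hη2)]
              exact Icc_subset_Icc_right hη2)
        have hi2 : IntervalIntegrable (fun θ : ℝ => tr u m (p + Complex.exp (θ * I) • (w - p)))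
            volume η (2 * Real.pi) := hi.mono_set (by
              rw [uIcc_of_le hη2, uIcc_of_le (hη.le.trans hη2)]
              exact Icc_subset_Icc_left hη.le)
        unfold pavg
        have hp2 : 0 ≤ (2 * Real.pi)⁻¹ := by positivity
        refine mul_le_mul_of_nonneg_left ?_ hp2
        rw [← intervalIntegral.integral_add_adjacent_intervals hi1 hi2]
        have e1 : ∫ θ in (0:ℝ)..η, tr u m (p + Complex.exp (θ * I) • (w - p)) ≤
            ∫ θ in (0:ℝ)..η, -(m : ℝ) := by
          refine intervalIntegral.integral_mono_on hη.le hi1 (by simp) fun θ hθ => ?_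
          have hb := hηb (y := θ) (by
            rw [Real.dist_eq, sub_zero, abs_of_nonneg hθ.1]; linarith [hθ.2])
          rw [← EReal.coe_le_coe_iff, coe_tr (hu.2.1 _ (hdisc.circ θ)), hb]
          simp
        have e2 : ∫ θ in η..(2 * Real.pi), tr u m (p + Complex.exp (θ * I) • (w - p)) ≤
            ∫ θ in η..(2 * Real.pi), (0 : ℝ) := by
          refine intervalIntegral.integral_mono_on hη2 hi2 (by simp) fun θ hθ => ?_
          exact tr_le (h0 _ (hdisc.circ θ)) m
        simp only [intervalIntegral.integral_const, smul_eq_mul, sub_zero, mul_zero] at e1 e2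
        linarith
      rw [EReal.eq_bot_iff_forall_lt]
      intro y
      obtain ⟨m, hm⟩ := exists_nat_gt (-y * (2 * Real.pi) / η)
      refine ((psh_iff.1 hu).2.2 p (w - p) hdisc m).trans_lt ?_
      rw [EReal.coe_lt_coe_iff]
      refine (hest m).trans_lt ?_
      have hpi : 0 < 2 * Real.pi := by positivity
      rw [div_lt_iff₀ hη] at hm
      rw [inv_mul_lt_iff₀ hpi]
      linarith
  obtain ⟨z, hz, hzb⟩ := hne
  exact hzb (interior_subset (hsub hz)).2

/-- Maximum principle. -/
lemma max_principle [FiniteDimensional ℂ E] [Nontrivial E] {G : E → ℝ} {D : Set E}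
    (hD : IsOpen D) (hbd : Bornology.IsBounded D) (hG : ContinuousOn G (closure D)) (hRP : RP G D)
    (hle : ∀ x ∈ frontier D, G x ≤ 0) : ∀ z ∈ D, G z ≤ 0 := by
  intro z hz
  obtain ⟨b, hb⟩ := exists_ne (0 : E)
  have hbn : 0 < ‖b‖ := norm_pos_iff.2 hb
  have hlc : Continuous (fun ζ : ℂ => z + ζ • b) := by fun_prop
  set K : Set ℂ := {ζ | z + ζ • b ∈ closure D} with hK
  have hKc : IsCompact K := by
    refine Metric.isCompact_of_isClosed_isBounded (isClosed_closure.preimage hlc) ?_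
    obtain ⟨R, hR⟩ := hbd.closure.exists_norm_le
    refine isBounded_iff_forall_norm_le.2 ⟨(R + ‖z‖) / ‖b‖, fun ζ hζ => ?_⟩
    have h1 := hR _ hζ
    rw [le_div_iff₀ hbn, ← norm_smul]
    have : ζ • b = (z + ζ • b) - z := by abel
    rw [this]
    exact (norm_sub_le _ _).trans (by linarith)
  have := max_principle_1d (h := fun ζ => G (z + ζ • b)) (K := K) (V := {ζ | z + ζ • b ∈ D}) hKc
    (hG.comp hlc.continuousOn fun ζ hζ => hζ).upperSemicontinuousOn ?_ ?_ 0 ?_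
  · simpa using this
  · intro ζ _ hζ
    obtain ⟨r, hr, hrs⟩ := Metric.nhds_basis_closedBall.mem_iff.1
      ((hD.preimage hlc).mem_nhds hζ)
    have hdisc : DiscIn (z + ζ • b) ((r : ℂ) • b) D := by
      intro ξ hξ
      have h4 : ζ + r * ξ ∈ closedBall ζ r := by
        simp only [mem_closedBall, dist_self_add_left, norm_mul, norm_real, Real.norm_eq_abs,
          abs_of_pos hr]
        nlinarith
      have h5 : z + (ζ + r * ξ) • b ∈ D := hrs h4
      convert h5 using 1
      module
    have heq : ∀ θ : ℝ, z + (ζ + r * Complex.exp (θ * I)) • b =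
        z + ζ • b + Complex.exp (θ * I) • (r : ℂ) • b := by
      intro θ; module
    refine ⟨r, hr, fun ξ hξ => subset_closure (hrs hξ), ?_, ?_⟩
    · simp only [heq]; exact hRP.pInt hdisc
    · simp only [heq]; exact hRP.mean _ _ hdisc
  · intro ζ hζ hζ'
    refine hle _ ?_
    rw [hD.frontier_eq]
    exact ⟨hζ, hζ'⟩
  · simpa [hK] using subset_closure hz
end Psh

section UscReg
set_option linter.unusedSectionVars false
variable {E : Type*} [NormedAddCommGroup E] [NormedSpace ℂ E]

lemma uscReg_bot_iff {u : E → EReal} {D : Set E} {x : E} :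
    uscReg u D x = ⊥ ↔ ∀ c : ℝ, ∀ᶠ z in 𝓝[D] x, u z < c := by
  constructor
  · intro h c
    have h2 : uscReg u D x < c := by rw [h]; exact EReal.bot_lt_coe c
    exact eventually_lt_of_limsup_lt h2
  · intro h
    rw [EReal.eq_bot_iff_forall_lt]
    intro c
    have : uscReg u D x ≤ ((c - 1 : ℝ) : EReal) :=
      limsup_le_of_le (h := (h (c-1)).mono fun z hz => hz.le)
    exact this.trans_lt (by exact_mod_cast sub_one_lt c)

lemma le_uscReg_of_freq {u : E → EReal} {D : Set E} {x : E} {c : EReal}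
    (h : ∃ᶠ z in 𝓝[D] x, c ≤ u z) : c ≤ uscReg u D x :=
  le_limsup_of_frequently_le h

lemma le_uscReg {u : E → EReal} {D : Set E} {x : E} (hx : x ∈ D) : u x ≤ uscReg u D x := by
  apply le_uscReg_of_freq
  intro h
  exact (h.self_of_nhdsWithin hx) le_rfl

lemma uscReg_eq_bot_of_usc {u : E → EReal} {D : Set E} {x : E} (hx : x ∈ D)
    (hu : UpperSemicontinuousOn u D) (h : u x = ⊥) : uscReg u D x = ⊥ := by
  rw [uscReg_bot_iff]
  intro c
  exact hu x hx c (by change u x < c; rw [h]; exact EReal.bot_lt_coe c)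

/-- Infinite sum of nonpositive functions, shifted by `-1`. -/
noncomputable def psum (F : ℕ → E → ℝ) (z : E) : EReal :=
  ⨅ N, ((-1 + ∑ i ∈ Finset.range N, F i z : ℝ) : EReal)

lemma psum_psh {F : ℕ → E → ℝ} {D : Set E} (hF : ∀ i, RP (F i) D)
    (h0 : ∀ i, ∀ z ∈ D, F i z ≤ 0) : PshOn (psum F) D := by
  refine psh_iInf (S := fun N z => -1 + ∑ i ∈ Finset.range N, F i z) ?_ ?_ ?_
  · intro N
    exact (RP.const (-1) D).add (RP.sum hF N)
  · intro N z hz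
    have := Finset.sum_nonpos (s := Finset.range N) fun i _ => h0 i z hz
    linarith
  · intro z hz
    refine antitone_nat_of_succ_le fun N => ?_
    simp only [Finset.sum_range_succ]
    linarith [h0 N z hz]

lemma psum_neg {F : ℕ → E → ℝ} {z : E} : psum F z < 0 := by
  refine (iInf_le _ 0).trans_lt ?_
  simp only [Finset.range_zero, Finset.sum_empty, add_zero]
  exact_mod_cast (by norm_num : (-1:ℝ) < 0)

lemma psum_ge {F : ℕ → E → ℝ} {z : E} {k : ℕ} (h1 : ∀ i, -1 ≤ F i z)
    (h2 : ∀ i, k ≤ i → -(1/2:ℝ)^i ≤ F i z) : ((-((k:ℝ)+3) : ℝ) : EReal) ≤ psum F z := by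
  refine le_iInf fun N => ?_
  rw [EReal.coe_le_coe_iff]
  have h3 : ∀ i ∈ Finset.range N, -((1/2:ℝ)^i + if i < k then 1 else 0) ≤ F i z := by
    intro i _
    have hp : 0 < (1/2:ℝ)^i := by positivity
    split_ifs with h
    · linarith [h1 i]
    · linarith [h2 i (not_lt.1 h)]
  have h4 := Finset.sum_le_sum h3
  rw [Finset.sum_neg_distrib, Finset.sum_add_distrib] at h4
  have h5 := sum_geometric_two_le N
  have h6 : ∑ i ∈ Finset.range N, (if i < k then (1:ℝ) else 0) ≤ k := by
    rw [Finset.sum_boole]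
    have : (Finset.filter (fun i => i < k) (Finset.range N)).card ≤ (Finset.range k).card :=
      Finset.card_le_card fun i hi => by simp at hi ⊢; exact hi.2
    rw [Finset.card_range] at this
    exact_mod_cast this
  linarith

lemma psum_ne_bot {F : ℕ → E → ℝ} {z : E} {k : ℕ} (h1 : ∀ i, -1 ≤ F i z)
    (h2 : ∀ i, k ≤ i → -(1/2:ℝ)^i ≤ F i z) : psum F z ≠ ⊥ :=
  ((EReal.bot_lt_coe _).trans_le (psum_ge h1 h2)).ne'

lemma psum_bot {F : ℕ → E → ℝ} {D : Set E} {x : E} {k : ℕ} (h0 : ∀ i, ∀ z ∈ D, F i z ≤ 0)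
    (h : ∀ i, k ≤ i → ∀ᶠ z in 𝓝[D] x, F i z ≤ -1/2) : uscReg (psum F) D x = ⊥ := by
  rw [uscReg_bot_iff]
  have key : ∀ M : ℕ, ∀ᶠ z in 𝓝[D] x, ∑ i ∈ Finset.range (k + M), F i z ≤ -(M:ℝ)/2 := by
    intro M
    induction M with
    | zero =>
      filter_upwards [self_mem_nhdsWithin] with z hz
      simpa using Finset.sum_nonpos (s := Finset.range k) fun i _ => h0 i z hz
    | succ M ih =>
      filter_upwards [ih, h (k+M) (by omega)] with z h1 h2
      rw [← add_assoc, Finset.sum_range_succ]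
      push_cast
      linarith
  intro c
  obtain ⟨M, hM⟩ := exists_nat_gt (2 * |c|)
  filter_upwards [key M] with z hz
  refine (iInf_le _ (k + M)).trans_lt ?_
  rw [EReal.coe_lt_coe_iff]
  linarith [neg_abs_le c]

lemma q_lemma [FiniteDimensional ℂ E] [Nontrivial E] {D : Set E} (hD : IsOpen D)
    (hbd : Bornology.IsBounded D) (hreg : BRegular D) {K L : Set E} (hK : IsClosed K)
    (hL : IsClosed L) (hKF : K ⊆ frontier D) (hLF : L ⊆ frontier D) (hKL : Disjoint K L) :
    ∃ Q : E → ℝ, RP Q D ∧ ContinuousOn Q (closure D) ∧ (∀ z ∈ D, -1 ≤ Q z) ∧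
      (∀ z ∈ D, Q z ≤ 0) ∧ (∀ x ∈ K, Q x = -1) ∧ ∀ x ∈ L, Q x = 0 := by
  have : ProperSpace E := FiniteDimensional.proper ℂ E
  obtain ⟨f, hf0, hf1, hf⟩ := exists_continuous_zero_one_of_isClosed hL hK hKL.symm
  obtain ⟨G, hGc, hGp, hGf⟩ := hreg (fun x => -f x) (by fun_prop)
  have hcpt : IsCompact (closure D) := hbd.isCompact_closure
  obtain ⟨C, hC⟩ := hcpt.exists_bound_of_continuousOn hGc
  have hGRP : RP G D := rp_of_psh hGp fun z hz => by simpa using hC z (subset_closure hz)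
  have hG0 := max_principle hD hbd hGc hGRP fun x hx => by
    rw [hGf x hx]; linarith [(hf x).1]
  refine ⟨fun z => max (G z) (-1), hGRP.max (RP.const _ D), ?_, fun z _ => le_max_right _ _,
    fun z hz => max_le (hG0 z hz) (by norm_num), fun x hx => ?_, fun x hx => ?_⟩
  · exact hGc.sup continuousOn_const
  · simp only [hGf x (hKF hx), hf1 hx]; simp
  · simp only [hGf x (hLF hx), hf0 hx]; simp

end UscReg

section PartOne
set_option linter.unusedSectionVars false
variable {E : Type*} [NormedAddCommGroup E] [NormedSpace ℂ E]

lemma net_lemma {u : E → EReal} {D : Set E} (hD : IsOpen D) (hc : IsPreconnected D)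
    (hu : PshOn u D) (h0 : ∀ z ∈ D, u z ≤ 0) (hne : ∃ z ∈ D, u z ≠ ⊥) {L : Set E}
    (hL : IsCompact L) (hLD : L ⊆ closure D) {P : E → Prop}
    (hP : ∀ x ∈ L, ∀ᶠ z in 𝓝[D] x, P z) {r : ℝ} (hr : 0 < r) :
    ∃ S : Finset E, (∀ s ∈ S, s ∈ D ∧ u s ≠ ⊥) ∧ ∀ x ∈ L, ∃ s ∈ S, dist s x < r ∧ P s := by
  classical
  have h1 : ∀ x : E, ∃ s : E, x ∈ L → s ∈ D ∧ u s ≠ ⊥ ∧ P s ∧ dist s x < r / 2 := by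
    intro x
    by_cases hx : x ∈ L
    · obtain ⟨ρ, hρ, hb⟩ := Metric.mem_nhdsWithin_iff.1 (hP x hx)
      obtain ⟨s, hs, hus⟩ := psh_dense hD hc hu h0 hne (O := ball x (min ρ (r/2))) isOpen_ball
        (by
          obtain ⟨b, hb, hb2⟩ := Metric.mem_closure_iff.1 (hLD hx) (min ρ (r/2)) (by positivity)
          exact ⟨b, by rw [mem_ball, dist_comm]; exact hb2, hb⟩)
      have hs1 : dist s x < min ρ (r/2) := hs.1
      exact ⟨s, fun _ => ⟨hs.2, hus, hb ⟨lt_of_lt_of_le hs1 (min_le_left _ _), hs.2⟩,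
        lt_of_lt_of_le hs1 (min_le_right _ _)⟩⟩
    · exact ⟨x, fun h => absurd h hx⟩
  choose s hs using h1
  obtain ⟨t, htL, ht⟩ := hL.elim_nhds_subcover (fun x => ball x (r/2))
    fun x _ => ball_mem_nhds x (by positivity)
  refine ⟨t.image s, ?_, ?_⟩
  · intro p hp
    obtain ⟨x, hx, rfl⟩ := Finset.mem_image.1 hp
    exact ⟨(hs x (htL x hx)).1, (hs x (htL x hx)).2.1⟩
  · intro y hy
    obtain ⟨x, hx, hxy⟩ := mem_iUnion₂.1 (ht hy)
    have h2 := hs x (htL x hx)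
    refine ⟨s x, Finset.mem_image_of_mem s hx, ?_, h2.2.2.1⟩
    have : dist x y < r/2 := by rw [dist_comm]; exact hxy
    linarith [dist_triangle (s x) x y, h2.2.2.2]

lemma finite_lower {u : E → EReal} {T : Finset E} (hT : ∀ s ∈ T, u s ≠ ⊥) :
    ∃ M : ℝ, 0 < M ∧ ∀ s ∈ T, ((-M : ℝ) : EReal) ≤ u s := by
  refine ⟨1 + ∑ s ∈ T, |(u s).toReal|, ?_, fun s hs => ?_⟩
  · have : 0 ≤ ∑ s ∈ T, |(u s).toReal| := Finset.sum_nonneg fun _ _ => abs_nonneg _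
    linarith
  · by_cases ht : u s = ⊤
    · rw [ht]; exact le_top
    rw [← EReal.coe_toReal ht (hT s hs), EReal.coe_le_coe_iff]
    have := Finset.single_le_sum (f := fun s => |(u s).toReal|) (fun _ _ => abs_nonneg _) hs
    linarith [neg_abs_le (u s).toReal]

lemma scaled {u : E → EReal} {D : Set E} (hu : PshOn u D) (h0 : ∀ z ∈ D, u z ≤ 0)
    {T : Finset E} (hT : ∀ s ∈ T, s ∈ D ∧ u s ≠ ⊥) {δ R : ℝ} (hδ : 0 < δ) :
    ∃ g : E → ℝ, ∃ m : ℕ, RP g D ∧ (∀ z ∈ D, g z ≤ 0) ∧ (∀ s ∈ T, -δ ≤ g s) ∧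
      (∀ z ∈ D, u z < ((-(m:ℝ) : ℝ) : EReal) → g z ≤ -R) := by
  obtain ⟨M, hM, hMT⟩ := finite_lower fun s hs => (hT s hs).2
  obtain ⟨m, hm⟩ := exists_nat_gt (R / (δ / M))
  have he : 0 < δ / M := by positivity
  refine ⟨fun z => δ / M * tr u m z, m, (hu.rp h0 m).mul he.le, fun z hz => ?_, fun s hs => ?_,
    fun z hz hzm => ?_⟩
  · exact mul_nonpos_of_nonneg_of_nonpos he.le (tr_le (h0 z hz) m)
  · have h1 : -M ≤ tr u m s := by
      rw [← EReal.coe_le_coe_iff]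
      exact (hMT s hs).trans (le_tr (hu.2.1 s (hT s hs).1) m)
    calc -δ = δ / M * (-M) := by field_simp
      _ ≤ _ := mul_le_mul_of_nonneg_left h1 he.le
  · have h1 : tr u m z = -(m:ℝ) := by
      rw [← EReal.coe_eq_coe_iff, coe_tr (hu.2.1 z hz), max_eq_right hzm.le]
    simp only [h1]
    rw [div_lt_iff₀ he] at hm
    linarith

lemma f_lemma {u : E → EReal} {D : Set E} (hu : PshOn u D) (h0 : ∀ z ∈ D, u z ≤ 0)
    {T : Finset E} (hT : ∀ s ∈ T, s ∈ D ∧ u s ≠ ⊥) {δ : ℝ} (hδ : 0 < δ) {Q : E → ℝ}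
    (hQ : RP Q D) (hQc : ContinuousOn Q (closure D)) (hQ1 : ∀ z ∈ D, -1 ≤ Q z)
    (hQ0 : ∀ z ∈ D, Q z ≤ 0) :
    ∃ F : E → ℝ, RP F D ∧ (∀ z ∈ D, -1 ≤ F z) ∧ (∀ z ∈ D, F z ≤ 0) ∧ (∀ z, Q z ≤ F z) ∧
      (∀ s ∈ T, -δ ≤ F s) ∧
      ∀ x ∈ closure D, Q x = -1 → uscReg u D x = ⊥ → ∀ᶠ z in 𝓝[D] x, F z ≤ -1/2 := by
  obtain ⟨g, m, hg, hg0, hgT, hgm⟩ := scaled hu h0 hT (R := 1) hδ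
  refine ⟨fun z => max (g z) (Q z), hg.max hQ, fun z hz => (hQ1 z hz).trans (le_max_right _ _),
    fun z hz => max_le (hg0 z hz) (hQ0 z hz), fun z => le_max_right _ _,
    fun s hs => (hgT s hs).trans (le_max_left _ _), fun x hx hxQ hxu => ?_⟩
  have h1 : ∀ᶠ z in 𝓝[D] x, Q z < -1/2 :=
    ((hQc x hx).mono subset_closure).eventually_lt_const (by rw [hxQ]; norm_num)
  filter_upwards [h1, uscReg_bot_iff.1 hxu (-(m:ℝ)), self_mem_nhdsWithin] with z h2 h3 h4
  exact max_le (by linarith [hgm z h4 h3]) h2.le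

theorem part_one [FiniteDimensional ℂ E] [Nontrivial E] {D : Set E} (hD : IsBddDomain D)
    (hreg : BRegular D) {A : Set E} (hA : A ⊆ frontier D) (hbp : BPluripolar A D)
    {C : ℕ → Set E} (hC : ∀ j, IsClosed (C j)) (hAC : A = ⋃ j, C j)
    {U : ℕ → Set E} (hU : ∀ j, IsOpen (U j)) (hAU : A = (⋂ j, U j) ∩ frontier D) :
    ∃ u : E → EReal, PshOn u D ∧ (∀ z ∈ D, u z < 0) ∧ (∃ z ∈ D, u z ≠ ⊥) ∧
        {z ∈ frontier D | uscReg u D z = ⊥} = A := by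
  classical
  have : ProperSpace E := FiniteDimensional.proper ℂ E
  obtain ⟨hDo, hDc, hDb⟩ := hD
  obtain ⟨u, hu, hu0, ⟨z0, hz0D, hz0⟩, huA⟩ := hbp
  have hFc : IsCompact (frontier D) :=
    hDb.isCompact_closure.of_isClosed_subset isClosed_frontier frontier_subset_closure
  set K : ℕ → Set E := fun i => ⋃ j ∈ Finset.range (i+1), C j with hKdef
  set L : ℕ → Set E := fun i => ⋃ j ∈ Finset.range (i+1), frontier D \ U j with hLdef
  have hKA : ∀ i, K i ⊆ A := fun i => by
    rw [hAC]; exact iUnion₂_subset fun j _ => subset_iUnion C j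
  have hLF : ∀ i, L i ⊆ frontier D := fun i => iUnion₂_subset fun j _ => sdiff_subset
  have hKc : ∀ i, IsClosed (K i) := fun i => isClosed_biUnion_finset fun j _ => hC j
  have hLc : ∀ i, IsClosed (L i) := fun i =>
    isClosed_biUnion_finset fun j _ => isClosed_frontier.sdiff (hU j)
  have hLmono : ∀ i k, k ≤ i → L k ⊆ L i := fun i k h => by
    refine biUnion_subset_biUnion_left fun j hj => ?_
    simp at hj ⊢; omega
  have hKmono : ∀ i k, k ≤ i → K k ⊆ K i := fun i k h => by
    refine biUnion_subset_biUnion_left fun j hj => ?_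
    simp at hj ⊢; omega
  have hdis : ∀ i, Disjoint (K i) (L i) := fun i => by
    rw [Set.disjoint_left]
    intro x hx hxL
    obtain ⟨j, _, hj⟩ := mem_iUnion₂.1 hxL
    have h1 := hKA i hx
    rw [hAU] at h1
    exact hj.2 (mem_iInter.1 h1.1 j)
  choose Q hQ hQc hQ1 hQ0 hQK hQL using fun i =>
    q_lemma hDo hDb hreg (hKc i) (hLc i) ((hKA i).trans hA) (hLF i) (hdis i)
  have hnet : ∀ j k : ℕ, ∃ S : Finset E, (∀ s ∈ S, s ∈ D ∧ u s ≠ ⊥) ∧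
      ∀ x ∈ L k, ∃ s ∈ S, dist s x < 1 / ((j:ℝ)+1) ∧
        ∀ i ∈ Finset.Icc k j, -(1/2:ℝ)^i ≤ Q i s := by
    intro j k
    refine net_lemma hDo hDc.isPreconnected hu hu0 ⟨z0, hz0D, hz0⟩
      (hFc.of_isClosed_subset (hLc k) (hLF k)) ((hLF k).trans frontier_subset_closure) ?_
      (by positivity)
    intro x hx
    rw [Filter.eventually_all_finset]
    intro i hi
    have hxi := hLmono i k (Finset.mem_Icc.1 hi).1 hx
    have h1 : ∀ᶠ z in 𝓝[D] x, -(1/2:ℝ)^i < Q i z :=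
      ((hQc i x (frontier_subset_closure (hLF k hx))).mono subset_closure).eventually_const_lt
        (by rw [hQL i x hxi]; simp)
    exact h1.mono fun z hz => hz.le
  choose S hSD hS using hnet
  set T : ℕ → Finset E := fun i => insert z0
    ((Finset.range i).biUnion fun j => (Finset.range (j+1)).biUnion fun k => S j k) with hTdef
  have hT : ∀ i, ∀ s ∈ T i, s ∈ D ∧ u s ≠ ⊥ := by
    intro i s hs
    simp only [hTdef, Finset.mem_insert, Finset.mem_biUnion] at hs
    rcases hs with rfl | ⟨j, _, k, _, hs⟩
    · exact ⟨hz0D, hz0⟩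
    · exact hSD j k s hs
  choose F hF hF1 hF0 hFQ hFT hFK using fun i =>
    f_lemma hu hu0 (hT i) (δ := (1/2:ℝ)^i) (by positivity) (hQ i) (hQc i) (hQ1 i) (hQ0 i)
  refine ⟨psum F, psum_psh hF hF0, fun z _ => psum_neg, ⟨z0, hz0D, ?_⟩, ?_⟩
  · exact psum_ne_bot (k := 0) (fun i => hF1 i z0 hz0D)
      fun i _ => hFT i z0 (Finset.mem_insert_self _ _)
  · apply Subset.antisymm
    · rintro x ⟨hxF, hx⟩
      by_contra hxA
      have : ∃ k, x ∈ L k := by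
        rw [hAU] at hxA
        have : x ∉ ⋂ j, U j := fun h => hxA ⟨h, hxF⟩
        rw [mem_iInter] at this
        push Not at this
        obtain ⟨k, hk⟩ := this
        exact ⟨k, mem_iUnion₂.2 ⟨k, by simp, hxF, hk⟩⟩
      obtain ⟨k, hk⟩ := this
      have hge : ((-((k:ℝ)+3) : ℝ) : EReal) ≤ uscReg (psum F) D x := by
        apply le_uscReg_of_freq
        rw [(nhdsWithin_basis_ball).frequently_iff]
        intro r hr
        obtain ⟨j0, hj0⟩ := exists_nat_one_div_lt hr
        set j := max j0 k
        obtain ⟨s, hsS, hsx, hsQ⟩ := hS j k x hk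
        have hsD := (hSD j k s hsS).1
        refine ⟨s, ⟨?_, hsD⟩, psum_ge (fun i => hF1 i s hsD) fun i hi => ?_⟩
        · rw [mem_ball]
          refine hsx.trans (lt_of_le_of_lt ?_ hj0)
          have : (j0:ℝ) ≤ j := by exact_mod_cast le_max_left _ _
          gcongr
        · by_cases hij : i ≤ j
          · exact (hsQ i (Finset.mem_Icc.2 ⟨hi, hij⟩)).trans (hFQ i s)
          · refine hFT i s ?_
            simp only [hTdef, Finset.mem_insert, Finset.mem_biUnion, Finset.mem_range]
            exact Or.inr ⟨j, by omega, k, Nat.lt_succ_of_le (le_max_right _ _), hsS⟩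
      rw [hx] at hge
      exact absurd hge (not_le.2 (EReal.bot_lt_coe _))
    · intro x hx
      refine ⟨hA hx, ?_⟩
      have hx2 := hx
      rw [hAC] at hx2
      obtain ⟨k, hk⟩ := mem_iUnion.1 hx2
      have hkK : x ∈ K k := mem_iUnion₂.2 ⟨k, by simp, hk⟩
      exact psum_bot (k := k) hF0 fun i hi => hFK i x (frontier_subset_closure (hA hx))
        (hQK i x (hKmono i k hi hkK)) (huA x hx)

end PartOne

section PartTwo
set_option linter.unusedSectionVars false
variable {E : Type*} [NormedAddCommGroup E] [NormedSpace ℂ E]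

lemma sup_rp [ProperSpace E] {g : E → ℝ} {D D' : Set E} {δ : ℝ} (hδ : 0 ≤ δ) (hg : RP g D)
    (hD' : ∀ z ∈ D', closedBall z δ ⊆ D) :
    ∃ h : E → ℝ, RP h D' ∧ (∀ z ∈ D', ∀ w ∈ closedBall z δ, g w ≤ h z) ∧
      ∀ z ∈ D', ∃ w ∈ closedBall z δ, h z = g w := by
  have hmax : ∀ z : E, ∃ p : E, z ∈ D' → p ∈ closedBall z δ ∧ ∀ w ∈ closedBall z δ, g w ≤ g p := by
    intro z
    by_cases hz : z ∈ D'
    · obtain ⟨p, hp, hpm⟩ := UpperSemicontinuousOn.exists_isMaxOn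
        (nonempty_closedBall.2 hδ) (isCompact_closedBall z δ) (hg.usc.mono (hD' z hz))
      exact ⟨p, fun _ => ⟨hp, fun w hw => hpm hw⟩⟩
    · exact ⟨z, fun h => absurd h hz⟩
  choose p hp using hmax
  have husc : UpperSemicontinuousOn (fun z => g (p z)) D' := by
    intro z hz y hy
    have hy2 : g (p z) < y := hy
    have hsub : closedBall z δ ⊆ interior {w | w ∈ D → g w < y} := by
      intro w hw
      rw [mem_interior_iff_mem_nhds]
      exact eventually_nhdsWithin_iff.1
        (hg.usc w (hD' z hz hw) y (((hp z hz).2 w hw).trans_lt hy2))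
    obtain ⟨η, hη, hth⟩ := (isCompact_closedBall z δ).exists_thickening_subset_open
      isOpen_interior hsub
    filter_upwards [mem_nhdsWithin_of_mem_nhds (ball_mem_nhds z hη), self_mem_nhdsWithin]
      with z' hz' hzD
    have hw := (hp z' hzD).1
    have : p z' ∈ thickening η (closedBall z δ) := by
      rw [mem_thickening_iff]
      refine ⟨p z' + (z - z'), ?_, ?_⟩
      · rw [mem_closedBall, dist_eq_norm] at hw ⊢
        convert hw using 2
        abel
      · rw [dist_eq_norm]
        rw [mem_ball, dist_eq_norm] at hz'
        convert hz' using 2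
        abel
    exact (interior_subset (hth this)) (hD' z' hzD hw)
  obtain ⟨C, hC⟩ := hg.bdd
  have hb : ∀ z ∈ D', |g (p z)| ≤ C := fun z hz => hC _ (hD' z hz (hp z hz).1)
  refine ⟨fun z => g (p z), ⟨husc, ⟨C, hb⟩, fun a b h => ?_⟩, fun z hz => (hp z hz).2,
    fun z hz => ⟨p z, (hp z hz).1, rfl⟩⟩
  have hcl : ∀ ζ : ℂ, p a + ζ • b ∈ closedBall (a + ζ • b) δ := by
    intro ζ
    have := (hp a h.center).1
    rw [mem_closedBall, dist_eq_norm] at this ⊢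
    convert this using 2
    abel
  have hd : DiscIn (p a) b D := fun ζ hζ => hD' _ (h ζ hζ) (hcl ζ)
  refine (hg.mean _ _ hd).trans (pavg_mono (hg.pInt hd) ?_ fun θ => ?_)
  · exact PInt.of_bdd (usc_circ husc h.circ).measurable fun θ => hb _ (h.circ θ)
  · exact (hp _ (h.circ θ)).2 _ (hcl _)

lemma local_step [FiniteDimensional ℂ E] [Nontrivial E] {D : Set E} (hD : IsOpen D)
    (hbd : Bornology.IsBounded D) (hreg : BRegular D) {K : Set E} (hK : IsClosed K)
    (hKF : K ⊆ frontier D) {u : E → EReal} (hu : PshOn u D) (h0 : ∀ z ∈ D, u z ≤ 0)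
    (huK : ∀ x ∈ K, uscReg u D x = ⊥) {y : E} (hy : y ∈ D) (huy : u y ≠ ⊥) {ε : ℝ} (hε : 0 < ε) :
    ∃ F : E → ℝ, RP F D ∧ (∀ z ∈ D, -1 ≤ F z) ∧ (∀ z ∈ D, F z ≤ 0) ∧
      (∀ x ∈ K, ∀ᶠ z in 𝓝[D] x, F z ≤ -1/2) ∧ ∃ δ > 0, ∀ z ∈ ball y δ, -ε ≤ F z := by
  have : ProperSpace E := FiniteDimensional.proper ℂ E
  obtain ⟨g, m, hg, hg0, hgT, hgm⟩ := scaled hu h0 (T := {y})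
    (by intro s hs; rw [Finset.mem_singleton] at hs; subst hs; exact ⟨hy, huy⟩)
    (δ := ε/2) (R := 1) (by positivity)
  have hgy : -(ε/2) ≤ g y := hgT y (Finset.mem_singleton_self y)
  set W : Set E := interior {z | z ∈ D → u z < ((-(m:ℝ) : ℝ) : EReal)} with hW
  have hKW : K ⊆ W := fun x hx => by
    rw [hW, mem_interior_iff_mem_nhds]
    exact eventually_nhdsWithin_iff.1 (uscReg_bot_iff.1 (huK x hx) _)
  obtain ⟨Q, hQ, hQc, hQ1, hQ0, hQK, hQL⟩ := q_lemma hD hbd hreg hK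
    (isClosed_frontier.sdiff (isOpen_interior : IsOpen W)) hKF sdiff_subset
    (Set.disjoint_left.2 fun x hx hx2 => hx2.2 (hKW hx))
  set V : Set E := interior {z | z ∈ D → -(ε/2) < Q z} with hV
  have hFc : IsCompact (frontier D) :=
    hbd.isCompact_closure.of_isClosed_subset isClosed_frontier frontier_subset_closure
  have hcov : frontier D ⊆ ⋃ b : Bool, (if b then W else V) := by
    intro x hx
    rw [mem_iUnion]
    by_cases hxW : x ∈ W
    · exact ⟨true, by simpa using hxW⟩
    · refine ⟨false, ?_⟩
      simp only [Bool.false_eq_true, if_false]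
      rw [hV, mem_interior_iff_mem_nhds]
      refine eventually_nhdsWithin_iff.1 ?_
      exact ((hQc x (frontier_subset_closure hx)).mono subset_closure).eventually_const_lt
        (by rw [hQL x ⟨hx, hxW⟩]; linarith)
  obtain ⟨η, hη, hleb⟩ := lebesgue_number_lemma_of_metric hFc
    (by intro b; cases b <;> simp [hW, hV]) hcov
  have hDne : D ≠ univ := by
    rintro rfl
    exact NormedSpace.unbounded_univ ℂ E hbd
  have hcne : (Dᶜ).Nonempty := nonempty_compl.2 hDne
  have hinf : ∀ z, z ∈ D ↔ 0 < infDist z Dᶜ := fun z => by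
    rw [← hD.isClosed_compl.notMem_iff_infDist_pos hcne]; simp
  have hd0 := (hinf y).1 hy
  set d0 := infDist y Dᶜ with hd0def
  obtain ⟨δ, hδ, hδη, hδd⟩ : ∃ δ > 0, 3 * δ ≤ η ∧ 3 * δ ≤ d0 :=
    ⟨min η d0 / 3, by positivity, by linarith [min_le_left η d0], by linarith [min_le_right η d0]⟩
  set D' : Set E := {z | δ < infDist z Dᶜ} with hD'def
  have hD'o : IsOpen D' := isOpen_lt continuous_const (continuous_infDist_pt _)
  have hD'D : D' ⊆ D := fun z hz => (hinf z).2 (hδ.trans hz)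
  have hD'b : ∀ z ∈ D', closedBall z δ ⊆ D := by
    intro z hz w hw
    by_contra hwD
    have h1 : infDist z Dᶜ ≤ dist z w := infDist_le_dist_of_mem hwD
    rw [mem_closedBall, dist_comm] at hw
    have h2 : δ < infDist z Dᶜ := hz
    linarith
  obtain ⟨h, hh, hhle, hhex⟩ := sup_rp hδ.le hg hD'b
  have hh0 : ∀ z ∈ D', h z ≤ 0 := fun z hz => by
    obtain ⟨w, hw, he⟩ := hhex z hz
    rw [he]; exact hg0 w (hD'b z hz hw)
  have hnear : ∀ z ∈ D', infDist z Dᶜ < 2 * δ → h z - ε/2 ≤ Q z := by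
    intro z hz hlt
    obtain ⟨x, hxF, hx⟩ := exists_mem_frontier_infDist_compl_eq_dist (hD'D hz) hDne
    rw [hx] at hlt
    obtain ⟨b, hb⟩ := hleb x hxF
    cases b with
    | true =>
      simp only [if_true] at hb
      obtain ⟨w, hw, he⟩ := hhex z hz
      have hwD := hD'b z hz hw
      have hwW : w ∈ W := hb (by
        rw [mem_closedBall] at hw
        rw [mem_ball]
        linarith [dist_triangle w z x])
      have := hgm w hwD (interior_subset hwW hwD)
      rw [he]
      linarith [hQ1 z (hD'D hz)]
    | false =>
      simp only [Bool.false_eq_true, if_false] at hb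
      have hzV : z ∈ V := hb (by rw [mem_ball]; linarith)
      have : -(ε/2) < Q z := interior_subset hzV (hD'D hz)
      linarith [hh0 z hz]
  classical
  set F : E → ℝ := fun z => if z ∈ D' then max (h z - ε/2) (Q z) else Q z with hFdef
  have hF1 : ∀ z ∈ D', F z = max (h z - ε/2) (Q z) := fun z hz => by simp [hFdef, hz]
  have hF2 : ∀ z, infDist z Dᶜ < 2 * δ → F z = Q z := fun z hz => by
    by_cases hz' : z ∈ D'
    · rw [hF1 z hz', max_eq_right (hnear z hz' hz)]
    · simp [hFdef, hz']
  have hFQ : ∀ z, Q z ≤ F z := fun z => by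
    by_cases hz' : z ∈ D'
    · rw [hF1 z hz']; exact le_max_right _ _
    · simp [hFdef, hz']
  have hF0 : ∀ z ∈ D, F z ≤ 0 := fun z hz => by
    by_cases hz' : z ∈ D'
    · rw [hF1 z hz']; exact max_le (by linarith [hh0 z hz']) (hQ0 z hz)
    · simpa [hFdef, hz'] using hQ0 z hz
  have hFm1 : ∀ z ∈ D, -1 ≤ F z := fun z hz => (hQ1 z hz).trans (hFQ z)
  refine ⟨F, ?_, hFm1, hF0, ?_, ?_⟩
  · refine RP.of_local ⟨1, fun z hz => abs_le.2 ⟨hFm1 z hz, (hF0 z hz).trans zero_le_one⟩⟩ ?_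
    intro z hz
    by_cases hz2 : infDist z Dᶜ < 2 * δ
    · have hO : IsOpen ({w | infDist w Dᶜ < 2 * δ} ∩ D) :=
        (isOpen_lt (continuous_infDist_pt _) continuous_const).inter hD
      obtain ⟨ρ, hρ, hs⟩ := Metric.isOpen_iff.1 hO z ⟨hz2, hz⟩
      exact ⟨ρ, hρ, fun w hw => (hs hw).2,
        (hQ.mono fun w hw => (hs hw).2).congr_on fun w hw => hF2 w (hs hw).1⟩
    · have hzD' : z ∈ D' := by
        change δ < infDist z Dᶜ
        linarith
      obtain ⟨ρ, hρ, hs⟩ := Metric.isOpen_iff.1 hD'o z hzD'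
      refine ⟨ρ, hρ, fun w hw => hD'D (hs hw), RP.congr_on (f := fun z => max (h z + -(ε/2)) (Q z))
        (((hh.mono hs).add (RP.const (-(ε/2)) _)).max (hQ.mono fun w hw => hD'D (hs hw))) ?_⟩
      intro w hw
      rw [hF1 w (hs hw), sub_eq_add_neg]
  · intro x hx
    have hxF := hKF hx
    have h1 : ∀ᶠ z in 𝓝[D] x, Q z < -1/2 :=
      ((hQc x (frontier_subset_closure hxF)).mono subset_closure).eventually_lt_const
        (by rw [hQK x hx]; norm_num)
    have hxD : x ∈ Dᶜ := fun h => by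
      rw [hD.frontier_eq] at hxF; exact hxF.2 h
    have h2 : ∀ᶠ z in 𝓝[D] x, infDist z Dᶜ < 2 * δ :=
      ((continuous_infDist_pt _).continuousAt.continuousWithinAt).eventually_lt_const
        (by change infDist x Dᶜ < 2 * δ; rw [infDist_zero_of_mem hxD]; positivity)
    filter_upwards [h1, h2] with z h3 h4
    rw [hF2 z h4]; exact h3.le
  · refine ⟨δ, hδ, fun z hz => ?_⟩
    rw [mem_ball] at hz
    have h1 : d0 ≤ infDist z Dᶜ + dist y z := infDist_le_infDist_add_dist
    rw [dist_comm] at h1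
    have hzD' : z ∈ D' := by
      change δ < infDist z Dᶜ
      linarith
    rw [hF1 z hzD']
    have := hhle z hzD' y (by rw [mem_closedBall, dist_comm]; exact hz.le)
    exact le_max_of_le_left (by linarith)

lemma compact_step [FiniteDimensional ℂ E] [Nontrivial E] {D : Set E} (hD : IsOpen D)
    (hbd : Bornology.IsBounded D) (hreg : BRegular D) {A K L : Set E} (hKA : K ⊆ A)
    (hK : IsClosed K) (hA : A ⊆ frontier D) (hL : IsCompact L) (hLD : L ⊆ D \ bHull A D)
    {ε : ℝ} (hε : 0 < ε) :
    ∃ F : E → ℝ, RP F D ∧ (∀ z ∈ D, -1 ≤ F z) ∧ (∀ z ∈ D, F z ≤ 0) ∧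
      (∀ x ∈ K, ∀ᶠ z in 𝓝[D] x, F z ≤ -1/2) ∧ ∀ z ∈ L, -ε ≤ F z := by
  refine hL.induction_on (p := fun L => ∃ F : E → ℝ, RP F D ∧ (∀ z ∈ D, -1 ≤ F z) ∧
      (∀ z ∈ D, F z ≤ 0) ∧ (∀ x ∈ K, ∀ᶠ z in 𝓝[D] x, F z ≤ -1/2) ∧ ∀ z ∈ L, -ε ≤ F z) ?_ ?_ ?_ ?_
  · exact ⟨fun _ => -1, RP.const _ D, fun _ _ => le_rfl, fun _ _ => by norm_num,
      fun _ _ => Eventually.of_forall fun _ => by norm_num, fun z hz => absurd hz (notMem_empty z)⟩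
  · rintro s t hst ⟨F, h1, h2, h3, h4, h5⟩
    exact ⟨F, h1, h2, h3, h4, fun z hz => h5 z (hst hz)⟩
  · rintro s t ⟨F, h1, h2, h3, h4, h5⟩ ⟨G, g1, g2, g3, g4, g5⟩
    refine ⟨fun z => max (F z) (G z), h1.max g1, fun z hz => le_max_of_le_left (h2 z hz),
      fun z hz => max_le (h3 z hz) (g3 z hz), fun x hx => ?_, ?_⟩
    · filter_upwards [h4 x hx, g4 x hx] with z a b using max_le a b
    · rintro z (hz | hz)
      · exact le_max_of_le_left (h5 z hz)
      · exact le_max_of_le_right (g5 z hz)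
  · intro y hy
    obtain ⟨hyD, hyn⟩ := hLD hy
    have : ∃ u : E → EReal, PshOn u D ∧ (∀ y ∈ D, u y < 0) ∧ (∃ y ∈ D, u y ≠ ⊥) ∧
        (∀ x ∈ A, uscReg u D x = ⊥) ∧ uscReg u D y ≠ ⊥ := by
      by_contra hcon
      push Not at hcon
      exact hyn ⟨subset_closure hyD, hcon⟩
    obtain ⟨u, hu, hu0, _, huA, huy⟩ := this
    obtain ⟨F, h1, h2, h3, h4, δ, hδ, h5⟩ := local_step hD hbd hreg hK (hKA.trans hA) hu
      (fun z hz => (hu0 z hz).le) (fun x hx => huA x (hKA hx)) hyD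
      (fun h => huy (uscReg_eq_bot_of_usc hyD hu.1 h)) hε
    exact ⟨ball y δ, mem_nhdsWithin_of_mem_nhds (ball_mem_nhds y hδ), F, h1, h2, h3, h4, h5⟩

theorem part_two [FiniteDimensional ℂ E] [Nontrivial E] {D : Set E} (hD : IsBddDomain D)
    (hreg : BRegular D) {A : Set E} (hA : A ⊆ frontier D)
    {C : ℕ → Set E} (hC : ∀ j, IsClosed (C j)) (hAC : A = ⋃ j, C j)
    {u : E → EReal} (hu : PshOn u D) (hu0 : ∀ z ∈ D, u z < 0) (hune : ∃ z ∈ D, u z ≠ ⊥)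
    (huA : {z ∈ frontier D | uscReg u D z = ⊥} = A)
    {U : ℕ → Set E} (hU : ∀ j, IsOpen (U j)) (hAU : bHull A D = (⋂ j, U j) ∩ closure D) :
    ∃ ψ : E → EReal, PshOn ψ D ∧ (∀ z ∈ D, ψ z < 0) ∧ (∃ z ∈ D, ψ z ≠ ⊥) ∧
        {z ∈ closure D | uscReg ψ D z = ⊥} = bHull A D := by
  have : ProperSpace E := FiniteDimensional.proper ℂ E
  obtain ⟨hDo, hDc, hDb⟩ := hD
  have hDne : D ≠ univ := by
    rintro rfl
    exact NormedSpace.unbounded_univ ℂ E hDb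
  have hcne : (Dᶜ).Nonempty := nonempty_compl.2 hDne
  have hinf : ∀ z, z ∈ D ↔ 0 < infDist z Dᶜ := fun z => by
    rw [← hDo.isClosed_compl.notMem_iff_infDist_pos hcne]; simp
  set K : ℕ → Set E := fun i => ⋃ j ∈ Finset.range (i+1), C j with hKdef
  have hKA : ∀ i, K i ⊆ A := fun i => by
    rw [hAC]; exact iUnion₂_subset fun j _ => subset_iUnion C j
  have hKc : ∀ i, IsClosed (K i) := fun i => isClosed_biUnion_finset fun j _ => hC j
  have hKmono : ∀ i k, k ≤ i → K k ⊆ K i := fun i k h => by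
    refine biUnion_subset_biUnion_left fun j hj => ?_
    simp at hj ⊢; omega
  set L : ℕ → Set E := fun i => closure D ∩ ({z | 1 / ((i:ℝ)+1) ≤ infDist z Dᶜ} ∩
    ⋃ j ∈ Finset.range (i+1), (U j)ᶜ) with hLdef
  have hLmono : ∀ i k, k ≤ i → L k ⊆ L i := fun i k h => by
    refine inter_subset_inter_right _ (inter_subset_inter ?_ ?_)
    · intro z hz
      refine le_trans ?_ (mem_ofPred.1 hz)
      have : (k:ℝ) ≤ i := by exact_mod_cast h
      gcongr
    · refine biUnion_subset_biUnion_left fun j hj => ?_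
      simp at hj ⊢; omega
  have hLc : ∀ i, IsCompact (L i) := fun i => by
    refine hDb.isCompact_closure.inter_right (IsClosed.inter ?_ ?_)
    · exact isClosed_le continuous_const (continuous_infDist_pt _)
    · exact isClosed_biUnion_finset fun j _ => (hU j).isClosed_compl
  have hLD : ∀ i, L i ⊆ D \ bHull A D := by
    rintro i z ⟨hz1, hz2, hz3⟩
    refine ⟨(hinf z).2 (lt_of_lt_of_le (by positivity) (mem_ofPred.1 hz2)), fun hz => ?_⟩
    rw [hAU] at hz
    obtain ⟨j, _, hj⟩ := mem_iUnion₂.1 hz3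
    exact hj (mem_iInter.1 hz.1 j)
  have hLex : ∀ z ∈ D, z ∉ bHull A D → ∃ k, z ∈ L k := by
    intro z hz hzn
    rw [hAU] at hzn
    have : z ∉ ⋂ j, U j := fun h => hzn ⟨h, subset_closure hz⟩
    rw [mem_iInter] at this
    push Not at this
    obtain ⟨k1, hk1⟩ := this
    obtain ⟨k2, hk2⟩ := exists_nat_one_div_lt ((hinf z).1 hz)
    refine ⟨max k1 k2, subset_closure hz, ?_, mem_iUnion₂.2 ⟨k1, ?_, hk1⟩⟩
    · refine le_trans ?_ hk2.le
      have : (k2:ℝ) ≤ ((max k1 k2 : ℕ) : ℝ) := by exact_mod_cast le_max_right _ _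
      gcongr
    · rw [Finset.mem_range]; exact Nat.lt_succ_of_le (le_max_left _ _)
  choose F hF hF1 hF0 hFK hFL using fun i =>
    compact_step hDo hDb hreg (hKA i) (hKc i) hA (hLc i) (hLD i) (ε := (1/2:ℝ)^i) (by positivity)
  have hpA : ∀ x ∈ A, uscReg (psum F) D x = ⊥ := by
    intro x hx
    rw [hAC] at hx
    obtain ⟨k, hk⟩ := mem_iUnion.1 hx
    have hkK : x ∈ K k := mem_iUnion₂.2 ⟨k, by simp, hk⟩
    exact psum_bot (k := k) hF0 fun i hi => hFK i x (hKmono i k hi hkK)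
  have hP : PshOn (fun z => max (u z) (psum F z)) D :=
    hu.max (psum_psh hF hF0) (fun z hz => (hu0 z hz).le) fun z _ => psum_neg.le
  have hneg : ∀ z ∈ D, max (u z) (psum F z) < 0 := fun z hz => max_lt (hu0 z hz) psum_neg
  have hne : ∃ z ∈ D, max (u z) (psum F z) ≠ ⊥ := by
    obtain ⟨z, hz, h⟩ := hune
    exact ⟨z, hz, fun h2 => h (le_bot_iff.1 (h2 ▸ le_max_left _ _))⟩
  refine ⟨fun z => max (u z) (psum F z), hP, hneg, hne, ?_⟩
  apply Subset.antisymm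
  · rintro z ⟨hzc, hz⟩
    have hz1 : uscReg u D z = ⊥ := by
      rw [uscReg_bot_iff] at hz ⊢
      exact fun c => (hz c).mono fun w hw => (le_max_left _ _).trans_lt hw
    by_cases hzD : z ∈ D
    · by_contra hzn
      obtain ⟨k, hk⟩ := hLex z hzD hzn
      have h1 : psum F z ≠ ⊥ := psum_ne_bot (k := k) (fun i => hF1 i z hzD)
        fun i hi => hFL i z (hLmono i k hi hk)
      have h2 := le_uscReg (u := fun z => max (u z) (psum F z)) hzD
      rw [hz] at h2
      exact h1 (le_bot_iff.1 ((le_max_right _ _).trans h2))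
    · have hzF : z ∈ frontier D := by rw [hDo.frontier_eq]; exact ⟨hzc, hzD⟩
      have hzA : z ∈ A := by rw [← huA]; exact ⟨hzF, hz1⟩
      exact ⟨hzc, fun v _ _ _ hvA => hvA z hzA⟩
  · rintro z ⟨hzc, hz⟩
    refine ⟨hzc, hz _ hP hneg hne fun x hx => ?_⟩
    have h1 : uscReg u D x = ⊥ := by
      have := hx
      rw [← huA] at this
      exact this.2
    rw [uscReg_bot_iff] at h1 ⊢
    intro c
    filter_upwards [h1 c, uscReg_bot_iff.1 (hpA x hx) c] with w a b using max_lt a b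

lemma const_case {D : Set E} (hDne : D.Nonempty) :
    PshOn (fun _ : E => (((-1:ℝ)) : EReal)) D ∧ (∀ z ∈ D, (fun _ : E => (((-1:ℝ)) : EReal)) z < 0) ∧
    (∃ z ∈ D, (fun _ : E => (((-1:ℝ)) : EReal)) z ≠ ⊥) ∧
    ∀ z ∈ closure D, uscReg (fun _ : E => (((-1:ℝ)) : EReal)) D z ≠ ⊥ := by
  refine ⟨(RP.const (-1) D).psh, fun z _ => EReal.coe_lt_coe_iff.2 (by norm_num : (-1:ℝ) < 0), ?_, ?_⟩
  · obtain ⟨z, hz⟩ := hDne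
    exact ⟨z, hz, EReal.coe_ne_bot _⟩
  · intro z hz
    have : (𝓝[D] z).NeBot := mem_closure_iff_nhdsWithin_neBot.1 hz
    unfold uscReg
    rw [limsup_const]
    exact EReal.coe_ne_bot _

end PartTwo

/-- Let `D` be B-regular.  (i) Every b-pluripolar `A ⊆ ∂D` that is
both a `G_δ` and an `F_σ` is completely b-pluripolar.  (ii) If, moreover, the
b-pluripolar hull `Â` is a `G_δ`, then `Â = {z ∈ cl(D) : ψ*(z) = -∞}` for some negative
`ψ ∈ PSH(D)`, `ψ ≢ -∞`; in particular `Â ∩ D` is completely pluripolar in `D`. -/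
theorem completely_bPluripolar_of_Gdelta_Fsigma {n : ℕ}
    (D : Set (EuclideanSpace ℂ (Fin n))) (hD : IsBddDomain D) (hreg : BRegular D) :
    (∀ A : Set (EuclideanSpace ℂ (Fin n)), A ⊆ frontier D → BPluripolar A D →
      (∃ C : ℕ → Set (EuclideanSpace ℂ (Fin n)), (∀ j, IsClosed (C j)) ∧ A = ⋃ j, C j) →
      (∃ U : ℕ → Set (EuclideanSpace ℂ (Fin n)),
        (∀ j, IsOpen (U j)) ∧ A = (⋂ j, U j) ∩ frontier D) →
      ∃ u : EuclideanSpace ℂ (Fin n) → EReal,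
        PshOn u D ∧ (∀ z ∈ D, u z < 0) ∧ (∃ z ∈ D, u z ≠ ⊥) ∧
        {z ∈ frontier D | uscReg u D z = ⊥} = A) ∧
    (∀ A : Set (EuclideanSpace ℂ (Fin n)), A ⊆ frontier D → BPluripolar A D →
      (∃ C : ℕ → Set (EuclideanSpace ℂ (Fin n)), (∀ j, IsClosed (C j)) ∧ A = ⋃ j, C j) →
      (∃ U : ℕ → Set (EuclideanSpace ℂ (Fin n)),
        (∀ j, IsOpen (U j)) ∧ A = (⋂ j, U j) ∩ frontier D) →
      (∃ U : ℕ → Set (EuclideanSpace ℂ (Fin n)),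
        (∀ j, IsOpen (U j)) ∧ bHull A D = (⋂ j, U j) ∩ closure D) →
      ∃ ψ : EuclideanSpace ℂ (Fin n) → EReal,
        PshOn ψ D ∧ (∀ z ∈ D, ψ z < 0) ∧ (∃ z ∈ D, ψ z ≠ ⊥) ∧
        {z ∈ closure D | uscReg ψ D z = ⊥} = bHull A D ∧
        ∃ v : EuclideanSpace ℂ (Fin n) → EReal,
          PshOn v D ∧ (∃ z ∈ D, v z ≠ ⊥) ∧
          {z ∈ D | v z = ⊥} = bHull A D ∩ D) := by
  have hcase : ∀ A : Set (EuclideanSpace ℂ (Fin n)), A ⊆ frontier D → A.Nonempty →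
      Nontrivial (EuclideanSpace ℂ (Fin n)) := by
    intro A hA hne
    by_contra hnt
    rw [not_nontrivial_iff_subsingleton] at hnt
    obtain ⟨x, hx⟩ := hne
    obtain ⟨y, hy⟩ := hD.2.1.nonempty
    have hxF := hA hx
    rw [hD.1.frontier_eq] at hxF
    exact hxF.2 (Subsingleton.elim y x ▸ hy)
  obtain ⟨hc1, hc2, hc3, hc4⟩ := const_case hD.2.1.nonempty
  constructor
  · rintro A hA hbp ⟨C, hC, hAC⟩ ⟨U, hU, hAU⟩
    rcases A.eq_empty_or_nonempty with h | h
    · refine ⟨_, hc1, hc2, hc3, ?_⟩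
      rw [h]
      exact eq_empty_of_forall_notMem fun z hz => hc4 z (frontier_subset_closure hz.1) hz.2
    · have := hcase A hA h
      exact part_one hD hreg hA hbp hC hAC hU hAU
  · rintro A hA hbp ⟨C, hC, hAC⟩ ⟨U, hU, hAU⟩ ⟨U', hU', hAU'⟩
    have key : ∃ ψ : EuclideanSpace ℂ (Fin n) → EReal,
        PshOn ψ D ∧ (∀ z ∈ D, ψ z < 0) ∧ (∃ z ∈ D, ψ z ≠ ⊥) ∧
        {z ∈ closure D | uscReg ψ D z = ⊥} = bHull A D := by
      rcases A.eq_empty_or_nonempty with h | h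
      · refine ⟨_, hc1, hc2, hc3, ?_⟩
        apply Subset.antisymm
        · exact fun z hz => absurd hz.2 (hc4 z hz.1)
        · intro z hz
          exact ⟨hz.1, hz.2 _ hc1 hc2 hc3 (by rw [h]; exact fun x hx => absurd hx (notMem_empty x))⟩
      · have := hcase A hA h
        obtain ⟨u, hu, hu0, hune, huA⟩ := part_one hD hreg hA hbp hC hAC hU hAU
        exact part_two hD hreg hA hC hAC hu hu0 hune huA hU' hAU'
    obtain ⟨ψ, h1, h2, h3, h4⟩ := key
    refine ⟨ψ, h1, h2, h3, h4, ψ, h1, h3, ?_⟩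
    apply Subset.antisymm
    · rintro z ⟨hz, hzb⟩
      refine ⟨?_, hz⟩
      rw [← h4]
      exact ⟨subset_closure hz, uscReg_eq_bot_of_usc hz h1.1 hzb⟩
    · rintro z ⟨hz, hzD⟩
      rw [← h4] at hz
      exact ⟨hzD, le_bot_iff.1 (hz.2 ▸ le_uscReg hzD)⟩
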